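/- arXiv:1209.4781 — 7 statements merged into one kernel-verified Lean document; each statement's English description precedes it below -/
import Mathlib

section
/- Let $T$ be a non-redundant decision tree structure on $n$ boolean variables with leaf set $\mathcal{L}$ of size $L$. Then $\mathbb{E}_{z \in \{0,1\}^L}[\bar{s}(T_z)] = \frac{1}{2} \mathbb{E}_{x \in \{0,1\}^n}[\text{length of the root-to-leaf path followed by } T \text{ on input } x]$, where $z$ and $x$ are uniform. -/
/-- A full binary tree: every internal vertex has exactly two children. -/
inductive BTree : Type where
  | leaf : BTree
  | node : BTree → BTree → BTree

namespace BTree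

/-- The depth of a full binary tree (maximum depth of a leaf; a single leaf has depth 0). -/
def depth : BTree → ℕ
  | .leaf => 0
  | .node l r => max l.depth r.depth + 1

/-- The minimum depth of a leaf of the tree. -/
def minDepth : BTree → ℕ
  | .leaf => 0
  | .node l r => min l.minDepth r.minDepth + 1

/-- The list of depths of the leaves of the tree. -/
def leafDepths : BTree → List ℕ
  | .leaf => [0]
  | .node l r => l.leafDepths.map (· + 1) ++ r.leafDepths.map (· + 1)

end BTree

/-- A decision tree on `n` boolean variables, with leaves labelled by elements of `α`:
a full binary tree whose internal vertices are labelled with variables (elements of `Fin n`),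
the two edges to the children corresponding to the value (false/true) of that variable. -/
inductive DTree (n : ℕ) (α : Type) : Type where
  | leaf : α → DTree n α
  | node : Fin n → DTree n α → DTree n α → DTree n α

namespace DTree

variable {n : ℕ} {α β : Type}

/-- Evaluate a decision tree on an input, returning the label of the leaf reached. -/
def eval : DTree n α → (Fin n → Bool) → α
  | .leaf a, _ => a
  | .node i l r, x => if x i then r.eval x else l.eval x

/-- Relabel the leaves of a decision tree. -/
def map (f : α → β) : DTree n α → DTree n β
  | .leaf a => .leaf (f a)
  | .node i l r => .node i (l.map f) (r.map f)

/-- The list of leaf labels of a decision tree. -/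
def leaves : DTree n α → List α
  | .leaf a => [a]
  | .node _ l r => l.leaves ++ r.leaves

/-- The depth of a decision tree (maximum depth of a leaf; a single leaf has depth 0). -/
def depth : DTree n α → ℕ
  | .leaf _ => 0
  | .node _ l r => max l.depth r.depth + 1

/-- The minimum depth of a leaf of a decision tree. -/
def minDepth : DTree n α → ℕ
  | .leaf _ => 0
  | .node _ l r => min l.minDepth r.minDepth + 1

/-- The length of the root-to-leaf path followed on input `x`
(equivalently, the depth of the leaf reached, i.e. the number of queries made). -/
def pathLen : DTree n α → (Fin n → Bool) → ℕ
  | .leaf _, _ => 0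
  | .node i l r, x => (if x i then r.pathLen x else l.pathLen x) + 1

/-- The depth of the leaf labelled `a` (assuming leaf labels are distinct). -/
def depthOf [DecidableEq α] : DTree n α → α → ℕ
  | .leaf _, _ => 0
  | .node _ l r, a => (if a ∈ l.leaves then l.depthOf a else r.depthOf a) + 1

/-- `t.NonRedundantFrom s` means no variable from `s` occurs in `t`, and no variable
occurs more than once on any root-to-leaf path of `t`. -/
def NonRedundantFrom : DTree n α → Finset (Fin n) → Prop
  | .leaf _, _ => True
  | .node i l r, s =>
      i ∉ s ∧ l.NonRedundantFrom (insert i s) ∧ r.NonRedundantFrom (insert i s)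

/-- A decision tree is non-redundant if no variable occurs more than once on any
root-to-leaf path. -/
def NonRedundant (t : DTree n α) : Prop := t.NonRedundantFrom ∅

/-- `t.Queries x i` means that on input `x`, some vertex on the root-to-leaf path
followed by `t` is labelled with variable `i`. -/
def Queries : DTree n α → (Fin n → Bool) → Fin n → Prop
  | .leaf _, _, _ => False
  | .node j l r, x, i => j = i ∨ (if x j then r.Queries x i else l.Queries x i)

end DTree

/-- The real number (0 or 1) corresponding to a boolean value. -/
noncomputable def b2r (b : Bool) : ℝ := if b then 1 else 0

/-- Flip the `i`-th bit of the boolean string `x`. -/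
def flipBit {n : ℕ} (x : Fin n → Bool) (i : Fin n) : Fin n → Bool :=
  Function.update x i (!x i)

/-- The average sensitivity (total influence) of a boolean function:
`s̄(f) = 2⁻ⁿ ∑_x ∑_i |f(x) - f(xⁱ)|`. -/
noncomputable def avgSens {n : ℕ} (f : (Fin n → Bool) → Bool) : ℝ :=
  (∑ x : Fin n → Bool, ∑ i : Fin n, |b2r (f x) - b2r (f (flipBit x i))|) / 2 ^ n

theorem DTree.aux_eval_map {n : ℕ} {α β : Type} (t : DTree n α) (z : α → β)
    (x : Fin n → Bool) : (t.map z).eval x = z (t.eval x) := by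
  induction t with
  | leaf a => rfl
  | node i l r hl hr =>
    simp only [DTree.map, DTree.eval]
    split_ifs
    · exact hr
    · exact hl

theorem DTree.aux_eval_mem {n : ℕ} {α : Type} (t : DTree n α) (x : Fin n → Bool) :
    t.eval x ∈ t.leaves := by
  induction t with
  | leaf a => simp [DTree.eval, DTree.leaves]
  | node i l r hl hr =>
    simp only [DTree.leaves, DTree.eval, List.mem_append]
    split_ifs
    · exact Or.inr hr
    · exact Or.inl hl

theorem DTree.aux_eval_flip {n : ℕ} {α : Type} (t : DTree n α) (x : Fin n → Bool)
    (i : Fin n) (s : Finset (Fin n)) (hs : i ∈ s) (h : t.NonRedundantFrom s) :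
    t.eval (flipBit x i) = t.eval x := by
  induction t generalizing s with
  | leaf a => rfl
  | node j l r hl hr =>
    obtain ⟨h1, h2, h3⟩ := h
    have hij : j ≠ i := fun e => h1 (e ▸ hs)
    have e : flipBit x i j = x j := by simp [flipBit, hij]
    simp only [DTree.eval, e]
    rw [hl _ (Finset.mem_insert_of_mem hs) h2, hr _ (Finset.mem_insert_of_mem hs) h3]

theorem DTree.aux_card {n : ℕ} {α : Type} [DecidableEq α] (t : DTree n α) (x : Fin n → Bool)
    (s : Finset (Fin n)) (h : t.NonRedundantFrom s) (hn : t.leaves.Nodup) :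
    (Finset.univ.filter (fun i => t.eval x ≠ t.eval (flipBit x i))).card = t.pathLen x := by
  induction t generalizing s with
  | leaf a => simp [DTree.eval, DTree.pathLen]
  | node j l r hl hr =>
    obtain ⟨h1, h2, h3⟩ := h
    simp only [DTree.leaves] at hn
    rw [List.nodup_append] at hn
    obtain ⟨n1, n2, n3⟩ := hn
    have hj : flipBit x j j = !x j := by simp [flipBit]
    have hne : ∀ i, i ≠ j → flipBit x i j = x j := fun i hi => by
      simp [flipBit, hi.symm]
    have key : ∀ u : DTree n α, u.NonRedundantFrom (insert j s) →
        (∀ y, (DTree.node j l r).eval y = if y j = x j then u.eval y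
          else (DTree.node j l r).eval y) →
        (DTree.node j l r).eval x ≠ (DTree.node j l r).eval (flipBit x j) →
        Finset.univ.filter (fun i => (DTree.node j l r).eval x
          ≠ (DTree.node j l r).eval (flipBit x i))
        = insert j (Finset.univ.filter (fun i => u.eval x ≠ u.eval (flipBit x i))) ∧
        j ∉ Finset.univ.filter (fun i => u.eval x ≠ u.eval (flipBit x i)) := by
      intro u hu he hd
      have hx := he x
      rw [if_pos rfl] at hx
      constructor
      · ext i
        by_cases hi : i = j
        · subst hi; simp only [Finset.mem_filter, Finset.mem_univ, true_and,
            Finset.mem_insert_self, iff_true]; exact hd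
        · have := he (flipBit x i)
          rw [if_pos (hne i hi)] at this
          simp [hx, this, hi]
      · simp [DTree.aux_eval_flip u x j _ (Finset.mem_insert_self j s) hu]
    cases hxj : x j with
    | true =>
      obtain ⟨e1, e2⟩ := key r h3 (by intro y; rw [hxj]; by_cases hy : y j <;> simp [DTree.eval, hy])
        (by
          simp only [DTree.eval, hj, hxj]
          simpa using (n3 _ (l.aux_eval_mem _) _ (r.aux_eval_mem _)).symm)
      rw [e1, Finset.card_insert_of_notMem e2, hr _ h3 n2]
      simp [DTree.pathLen, hxj]
    | false =>
      obtain ⟨e1, e2⟩ := key l h2 (by intro y; rw [hxj]; by_cases hy : y j <;> simp [DTree.eval, hy])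
        (by
          simp only [DTree.eval, hj, hxj]
          simpa using (n3 _ (l.aux_eval_mem _) _ (r.aux_eval_mem _)))
      rw [e1, Finset.card_insert_of_notMem e2, hl _ h2 n1]
      simp [DTree.pathLen, hxj]

theorem aux_sum_z (L : ℕ) (a b : Fin L) :
    ∑ z : Fin L → Bool, |b2r (z a) - b2r (z b)| = if a ≠ b then (2 : ℝ) ^ L / 2 else 0 := by
  split_ifs with h
  · have inv : Function.Involutive (fun z : Fin L → Bool => flipBit z a) := by
      intro z; simp [flipBit]
    have h1 := Equiv.sum_comp (Function.Involutive.toPerm _ inv) (fun z : Fin L → Bool => |b2r (z a) - b2r (z b)|)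
    have h2 : ∑ z : Fin L → Bool, (|b2r (z a) - b2r (z b)|
        + |b2r ((Function.Involutive.toPerm _ inv) z a) - b2r ((Function.Involutive.toPerm _ inv) z b)|) = 2 ^ L := by
      rw [Finset.sum_congr rfl (g := fun _ => (1 : ℝ))]
      · simp
      · intro z _
        have ha : (Function.Involutive.toPerm _ inv) z a = !z a := by simp [flipBit]
        have hb : (Function.Involutive.toPerm _ inv) z b = z b := by simp [flipBit, Ne.symm h]
        rw [ha, hb]
        cases z a <;> cases z b <;> simp [b2r]
    rw [Finset.sum_add_distrib, h1] at h2
    linarith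
  · push Not at h
    simp [h]

/-- Let `T` be a non-redundant decision tree structure on `n` boolean
variables with leaf set indexed by `Fin L` (each index occurring at exactly one leaf).
Then `E_{z ∈ {0,1}^L}[s̄(T_z)] = (1/2) · E_{x ∈ {0,1}ⁿ}[length of the root-to-leaf path
followed by T on input x]`, where `z` and `x` are uniform. -/
theorem expected_avgSens_eq_half_expected_path_length (n L : ℕ) (t : DTree n (Fin L))
    (ht : t.NonRedundant) (hnodup : t.leaves.Nodup)
    (hsurj : ∀ j : Fin L, j ∈ t.leaves) :
    (∑ z : Fin L → Bool, avgSens (fun x => (t.map z).eval x)) / 2 ^ L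
      = (1 / 2) * ((∑ x : Fin n → Bool, (t.pathLen x : ℝ)) / 2 ^ n) := by
  have h1 : ∑ z : Fin L → Bool, avgSens (fun x => (t.map z).eval x)
      = (∑ x : Fin n → Bool, (t.pathLen x : ℝ) * (2 ^ L / 2)) / 2 ^ n := by
    simp only [avgSens, DTree.aux_eval_map]
    rw [← Finset.sum_div, Finset.sum_comm]
    congr 1
    refine Finset.sum_congr rfl fun x _ => ?_
    rw [Finset.sum_comm]
    simp only [aux_sum_z]
    rw [← Finset.sum_filter, Finset.sum_const, DTree.aux_card t x ∅ ht hnodup, nsmul_eq_mul]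
  rw [h1, ← Finset.sum_mul]
  field_simp
end

section
/- Let $T$ be a non-redundant decision tree structure on $n$ boolean variables with leaf set $\mathcal{L}$ of size $L$. Then $\mathbb{E}_{z \in \{0,1\}^L}[\bar{s}(T_z)] = \frac{1}{2} \sum_{\ell \in \mathcal{L}} d(\ell) \, 2^{-d(\ell)}$, where $z$ is uniform and $d(\ell)$ is the depth of leaf $\ell$. -/
theorem flipBit_flipBit {n : ℕ} (x : Fin n → Bool) (i : Fin n) :
    flipBit (flipBit x i) i = x := by
  simp [flipBit]

theorem flipBit_same {n : ℕ} (x : Fin n → Bool) (i : Fin n) :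
    flipBit x i i = !x i := by
  simp [flipBit]

theorem flipBit_ne {n : ℕ} (x : Fin n → Bool) {i j : Fin n} (h : j ≠ i) :
    flipBit x i j = x j := by
  simp [flipBit, h]

theorem sum_flipBit {n : ℕ} (i : Fin n) (G : (Fin n → Bool) → ℝ) :
    ∑ x, G (flipBit x i) = ∑ x, G x :=
  Equiv.sum_comp (Function.Involutive.toPerm (fun x => flipBit x i)
    (fun x => flipBit_flipBit x i)) G

theorem sum_z {L : ℕ} (a b : Fin L) :
    ∑ z : Fin L → Bool, |b2r (z a) - b2r (z b)| = if a = b then 0 else 2 ^ L / 2 := by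
  split_ifs with h
  · simp [h]
  · have h1 := sum_flipBit a (fun z => |b2r (z a) - b2r (z b)|)
    have h2 : ∑ z : Fin L → Bool, (|b2r (z a) - b2r (z b)|
        + |b2r (flipBit z a a) - b2r (flipBit z a b)|) = 2 ^ L := by
      rw [Finset.sum_congr rfl (g := fun _ => (1 : ℝ))]
      · simp
      · intro z _
        rw [flipBit_same, flipBit_ne z (Ne.symm h)]
        cases z a <;> cases z b <;> simp [b2r]
    rw [Finset.sum_add_distrib] at h2
    linarith

theorem sum_half {n : ℕ} (i : Fin n) (b : Bool) (G : (Fin n → Bool) → ℝ)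
    (hG : ∀ x, G (flipBit x i) = G x) :
    ∑ x, (if x i = b then G x else 0) = (∑ x, G x) / 2 := by
  have h1 := sum_flipBit i (fun x => if x i = b then G x else 0)
  have h2 : ∑ x : Fin n → Bool, ((if x i = b then G x else 0)
      + (if flipBit x i i = b then G (flipBit x i) else 0)) = ∑ x, G x := by
    refine Finset.sum_congr rfl fun x _ => ?_
    rw [flipBit_same, hG]
    cases x i <;> cases b <;> simp
  rw [Finset.sum_add_distrib] at h2
  linarith

namespace DTree

theorem eval_map' {n : ℕ} {α β : Type} (f : α → β) (t : DTree n α) (x : Fin n → Bool) :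
    (t.map f).eval x = f (t.eval x) := by
  induction t with
  | leaf a => rfl
  | node i l r hl hr => simp only [map, eval, hl, hr]; split_ifs <;> rfl

theorem eval_mem {n : ℕ} {α : Type} (t : DTree n α) (x : Fin n → Bool) :
    t.eval x ∈ t.leaves := by
  induction t with
  | leaf a => simp [eval, leaves]
  | node i l r hl hr =>
    simp only [eval, leaves, List.mem_append]
    split_ifs
    · exact Or.inr hr
    · exact Or.inl hl

theorem eval_flip {n : ℕ} {α : Type} (t : DTree n α) (s : Finset (Fin n))
    (h : t.NonRedundantFrom s) (i : Fin n) (hi : i ∈ s) (x : Fin n → Bool) :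
    t.eval (flipBit x i) = t.eval x := by
  induction t generalizing s with
  | leaf a => rfl
  | node j l r hl hr =>
    obtain ⟨h1, h2, h3⟩ := h
    have hji : j ≠ i := fun e => h1 (e ▸ hi)
    simp only [eval, flipBit_ne x hji,
      hl _ h2 (Finset.mem_insert_of_mem hi), hr _ h3 (Finset.mem_insert_of_mem hi)]

theorem count_eq {n L : ℕ} (t : DTree n (Fin L)) (s : Finset (Fin n))
    (h : t.NonRedundantFrom s) (hn : t.leaves.Nodup) (x : Fin n → Bool) :
    ∑ i : Fin n, (if t.eval x = t.eval (flipBit x i) then (0 : ℝ) else 1)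
      = t.depthOf (t.eval x) := by
  induction t generalizing s with
  | leaf a => simp [eval, depthOf]
  | node j l r hl hr =>
    obtain ⟨h1, h2, h3⟩ := h
    simp only [leaves] at hn
    rw [List.nodup_append] at hn
    obtain ⟨n1, n2, n3⟩ := hn
    have key : ∀ u : DTree n (Fin L), u.NonRedundantFrom (insert j s) →
        (∀ i, i ≠ j → (node j l r).eval (flipBit x i) = u.eval (flipBit x i)) →
        (node j l r).eval x = u.eval x →
        (node j l r).eval x ≠ (node j l r).eval (flipBit x j) →
        ∑ i : Fin n, (if (node j l r).eval x = (node j l r).eval (flipBit x i)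
          then (0 : ℝ) else 1)
        = ∑ i : Fin n, (if u.eval x = u.eval (flipBit x i) then (0 : ℝ) else 1) + 1 := by
      intro u hu hi hx hj
      rw [Fintype.sum_eq_add_sum_compl j,
        Fintype.sum_eq_add_sum_compl j
          (fun i => if u.eval x = u.eval (flipBit x i) then (0 : ℝ) else 1)]
      rw [if_neg hj, if_pos (eval_flip u _ hu j (Finset.mem_insert_self _ _) x).symm]
      rw [zero_add, add_comm]
      congr 1
      refine Finset.sum_congr rfl fun i hi' => ?_
      have : i ≠ j := by simpa using hi'
      rw [hi i this, hx]
    cases hxj : x j with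
    | true =>
      have e : (node j l r).eval x = r.eval x := by simp [eval, hxj]
      have hnl : r.eval x ∉ l.leaves := fun hm => n3 _ hm _ (eval_mem r x) rfl
      rw [key r h3 (fun i hi => by simp [eval, flipBit_ne x hi.symm, hxj]) e ?_, hr _ h3 n2, e]
      · simp [depthOf, hnl]
      · rw [e]
        simp only [eval, flipBit_same, hxj]
        exact fun hm => n3 _ (eval_mem l (flipBit x j)) _ (eval_mem r x) (by simpa using hm.symm)
    | false =>
      have e : (node j l r).eval x = l.eval x := by simp [eval, hxj]
      rw [key l h2 (fun i hi => by simp [eval, flipBit_ne x hi.symm, hxj]) e ?_, hl _ h2 n1, e]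
      · simp [depthOf, eval_mem l x]
      · rw [e]
        simp only [eval, flipBit_same, hxj]
        exact fun hm => n3 _ (eval_mem l x) _ (eval_mem r (flipBit x j)) (by simpa using hm)

theorem prob_eq {n L : ℕ} (t : DTree n (Fin L)) (s : Finset (Fin n))
    (h : t.NonRedundantFrom s) (hn : t.leaves.Nodup) (a : Fin L) (ha : a ∈ t.leaves) :
    ∑ x : Fin n → Bool, (if t.eval x = a then (1 : ℝ) else 0)
      = 2 ^ n * (2 : ℝ) ^ (-(t.depthOf a : ℤ)) := by
  induction t generalizing s with
  | leaf b =>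
    have : b = a := by simpa [leaves, eq_comm] using ha
    simp [eval, depthOf, this]
  | node j l r hl hr =>
    obtain ⟨h1, h2, h3⟩ := h
    simp only [leaves] at hn ha
    rw [List.nodup_append] at hn
    obtain ⟨n1, n2, n3⟩ := hn
    have hpow : ∀ k : ℕ, (2 : ℝ) ^ (-((k + 1 : ℕ) : ℤ)) = (2 : ℝ) ^ (-(k : ℤ)) / 2 := by
      intro k
      rw [zpow_neg, zpow_neg, zpow_natCast, zpow_natCast, pow_succ]
      field_simp
    by_cases hal : a ∈ l.leaves
    · have hr' : ∀ x, r.eval x ≠ a := fun x e => n3 _ hal _ (eval_mem r x) e.symm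
      have hd : (node j l r).depthOf a = l.depthOf a + 1 := by simp [depthOf, hal]
      rw [hd, hpow, ← mul_div_assoc, ← hl _ h2 n1 hal, ← sum_half j false]
      · refine Finset.sum_congr rfl fun x _ => ?_
        cases hx : x j <;> simp [eval, hx, hr']
      · intro x
        rw [eval_flip l _ h2 j (Finset.mem_insert_self _ _)]
    · have har : a ∈ r.leaves := (List.mem_append.1 ha).resolve_left hal
      have hl' : ∀ x, l.eval x ≠ a := fun x e => hal (e ▸ eval_mem l x)
      have hd : (node j l r).depthOf a = r.depthOf a + 1 := by simp [depthOf, hal]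
      rw [hd, hpow, ← mul_div_assoc, ← hr _ h3 n2 har, ← sum_half j true]
      · refine Finset.sum_congr rfl fun x _ => ?_
        cases hx : x j <;> simp [eval, hx, hl']
      · intro x
        rw [eval_flip r _ h3 j (Finset.mem_insert_self _ _)]

end DTree

/-- Let `T` be a non-redundant decision tree structure on `n` boolean
variables with leaf set indexed by `Fin L` (each index occurring at exactly one leaf).
Then `E_{z ∈ {0,1}^L}[s̄(T_z)] = (1/2) ∑_{ℓ} d(ℓ) 2^{-d(ℓ)}`, where `z` is uniform and
`d(ℓ)` is the depth of leaf `ℓ`. -/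
theorem expected_avgSens_eq_sum_over_leaves (n L : ℕ) (t : DTree n (Fin L))
    (ht : t.NonRedundant) (hnodup : t.leaves.Nodup)
    (hsurj : ∀ j : Fin L, j ∈ t.leaves) :
    (∑ z : Fin L → Bool, avgSens (fun x => (t.map z).eval x)) / 2 ^ L
      = (1 / 2) * ∑ ℓ : Fin L, (t.depthOf ℓ : ℝ) * (2 : ℝ) ^ (-(t.depthOf ℓ : ℤ)) := by
  have hL : (2 : ℝ) ^ L ≠ 0 := by positivity
  have hN : (2 : ℝ) ^ n ≠ 0 := by positivity
  have h1 : ∑ z : Fin L → Bool, avgSens (fun x => (t.map z).eval x)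
      = (2 ^ L / 2) * (∑ x : Fin n → Bool, (t.depthOf (t.eval x) : ℝ)) / 2 ^ n := by
    simp only [avgSens, DTree.eval_map']
    rw [← Finset.sum_div, Finset.sum_comm, Finset.mul_sum]
    congr 1
    refine Finset.sum_congr rfl fun x _ => ?_
    rw [Finset.sum_comm, ← DTree.count_eq t _ ht hnodup x, Finset.mul_sum]
    refine Finset.sum_congr rfl fun i _ => ?_
    rw [sum_z]
    split_ifs <;> simp
  have h2 : ∑ x : Fin n → Bool, (t.depthOf (t.eval x) : ℝ)
      = 2 ^ n * ∑ ℓ : Fin L, (t.depthOf ℓ : ℝ) * (2 : ℝ) ^ (-(t.depthOf ℓ : ℤ)) := by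
    have h3 : ∀ x : Fin n → Bool, (t.depthOf (t.eval x) : ℝ)
        = ∑ ℓ : Fin L, (t.depthOf ℓ : ℝ) * (if t.eval x = ℓ then (1 : ℝ) else 0) := by
      intro x
      simp
    rw [Finset.sum_congr rfl fun x _ => h3 x, Finset.sum_comm, Finset.mul_sum]
    refine Finset.sum_congr rfl fun a _ => ?_
    rw [← Finset.mul_sum, DTree.prob_eq t _ ht hnodup a (hsurj a)]
    ring
  rw [h1, h2]
  field_simp
end

section
/- Let $d \ge 1$ and let $h$ be a nonnegative integer with $h \le d - \log_2 d - 2$. Then $\sum_{k=0}^{h} \frac{2^k}{N_{d-k}} \le 2^{1 - 2^{d-h-2}}$, where $N_j$ is the number of full binary trees of depth at most $j$ (satisfying $N_0 = 1$, $N_j = N_{j-1}^2 + 1$). -/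
/-- Let `d ≥ 1` and let `h` be a nonnegative integer with
`h ≤ d - log₂ d - 2`. Then `∑_{k=0}^{h} 2^k / N_{d-k} ≤ 2^{1 - 2^{d-h-2}}`, where
`N j` is the number of full binary trees of depth at most `j`
(satisfying `N 0 = 1`, `N j = N (j-1)² + 1`). -/
theorem sum_leaf_prob_bound (N : ℕ → ℕ) (h0 : N 0 = 1)
    (hrec : ∀ j : ℕ, 1 ≤ j → N j = N (j - 1) ^ 2 + 1)
    (d h : ℕ) (hd : 1 ≤ d) (hh : (h : ℝ) ≤ (d : ℝ) - Real.logb 2 d - 2) :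
    ∑ k ∈ Finset.range (h + 1), (2 ^ k : ℝ) / N (d - k)
      ≤ (2 : ℝ) ^ ((1 : ℤ) - 2 ^ (d - h - 2)) := by
  have hdpos : (0 : ℝ) < d := by exact_mod_cast hd
  have hlog : 0 ≤ Real.logb 2 (d : ℝ) :=
    Real.logb_nonneg (by norm_num) (by exact_mod_cast hd)
  have hle : h + 2 ≤ d := by
    have : (h : ℝ) + 2 ≤ d := by linarith
    exact_mod_cast this
  obtain ⟨m, rfl⟩ := Nat.exists_eq_add_of_le hle
  have hm : h + 2 + m - h - 2 = m := by omega
  rw [hm]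
  have hdm : h + 2 + m ≤ 2 ^ m := by
    have h1 : Real.logb 2 ((h + 2 + m : ℕ) : ℝ) ≤ (m : ℝ) := by
      push_cast at hh ⊢
      linarith
    rw [Real.logb_le_iff_le_rpow (by norm_num) hdpos, Real.rpow_natCast] at h1
    exact_mod_cast h1
  have hN : ∀ j : ℕ, 2 ^ 2 ^ j ≤ N (j + 1) := by
    intro j
    induction j with
    | zero =>
      have := hrec 1 le_rfl
      simp [h0] at this
      simp [this]
    | succ j ih =>
      have h1 := hrec (j + 1 + 1) (by omega)
      have h2 := Nat.pow_le_pow_left ih 2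
      rw [Nat.add_sub_cancel] at h1
      rw [h1, pow_succ 2 j, pow_mul]
      omega
  have hterm : ∀ k ∈ Finset.range (h + 1),
      (2 ^ k : ℝ) / N (h + 2 + m - k) ≤ 2 ^ k / 2 ^ 2 ^ (m + 1) := by
    intro k hk
    have hk' : k ≤ h := by
      have := Finset.mem_range.mp hk
      omega
    have e : h + 2 + m - k = (h - k + (m + 1)) + 1 := by omega
    have h1 : 2 ^ 2 ^ (m + 1) ≤ N (h + 2 + m - k) := by
      rw [e]
      refine le_trans ?_ (hN _)
      exact Nat.pow_le_pow_right (by norm_num)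
        (Nat.pow_le_pow_right (by norm_num) (by omega))
    have h2 : (2 : ℝ) ^ 2 ^ (m + 1) ≤ N (h + 2 + m - k) := by exact_mod_cast h1
    exact div_le_div_of_nonneg_left (by positivity) (by positivity) h2
  refine (Finset.sum_le_sum hterm).trans ?_
  rw [← Finset.sum_div, geom_sum_eq (by norm_num)]
  have hR : (2 : ℝ) ^ ((1 : ℤ) - 2 ^ m) = 2 / 2 ^ 2 ^ m := by
    rw [zpow_sub₀ (by norm_num), zpow_one]
    congr 1
  have hP : (2 : ℝ) ^ h ≤ 2 ^ 2 ^ m := pow_le_pow_right₀ (by norm_num) (by omega)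
  rw [hR, pow_succ 2 m, pow_mul, div_le_div_iff₀ (by positivity) (by positivity), pow_succ 2 h]
  have hp : (0 : ℝ) < 2 ^ 2 ^ m := by positivity
  generalize (2 : ℝ) ^ 2 ^ m = P at *
  norm_num
  nlinarith
end

section
/- Let $T$ be picked uniformly at random from the set of full binary trees of depth at most $d$, where $d \ge 1$. Then for any nonnegative integer $h \le d - \log_2 d - 2$, the probability that $T$ has a leaf of depth at most $h$ is at most $2^{1 - 2^{d-h-2}}$. Equivalently, the number of full binary trees of depth at most $d$ having some leaf of depth at most $h$ is at most $2^{1 - 2^{d-h-2}} N_d$, where $N_d$ is the total number of full binary trees of depth at most $d$. -/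
namespace BTree

theorem setOf_depth_succ (d : ℕ) : {t : BTree | t.depth ≤ d + 1} =
    insert BTree.leaf (Set.image (fun p : BTree × BTree => BTree.node p.1 p.2)
      ({t : BTree | t.depth ≤ d} ×ˢ {t : BTree | t.depth ≤ d})) := by
  ext t
  cases t with
  | leaf => simp [depth]
  | node l r => simp [depth]

theorem setOf_depth_zero : {t : BTree | t.depth ≤ 0} = {BTree.leaf} := by
  ext t
  cases t with
  | leaf => simp [depth]
  | node l r => simp [depth]

theorem node_injective : Function.Injective (fun p : BTree × BTree => BTree.node p.1 p.2) := by
  rintro ⟨a, b⟩ ⟨c, e⟩ h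
  simpa using h

theorem finite_depth (d : ℕ) : {t : BTree | t.depth ≤ d}.Finite := by
  induction d with
  | zero => rw [setOf_depth_zero]; exact Set.finite_singleton _
  | succ d ih => rw [setOf_depth_succ]; exact ((ih.prod ih).image _).insert _

theorem ncard_zero : Set.ncard {t : BTree | t.depth ≤ 0} = 1 := by
  rw [setOf_depth_zero, Set.ncard_singleton]

theorem ncard_succ (d : ℕ) : Set.ncard {t : BTree | t.depth ≤ d + 1} =
    Set.ncard {t : BTree | t.depth ≤ d} ^ 2 + 1 := by
  have hf := finite_depth d
  rw [setOf_depth_succ, Set.ncard_insert_of_notMem (by simp) ((hf.prod hf).image _),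
    Set.ncard_image_of_injective _ node_injective, Set.ncard_prod, sq]

theorem bad_zero (d : ℕ) : Set.ncard {t : BTree | t.depth ≤ d ∧ t.minDepth ≤ 0} ≤ 1 := by
  have : {t : BTree | t.depth ≤ d ∧ t.minDepth ≤ 0} ⊆ {BTree.leaf} := by
    intro t ht
    cases t with
    | leaf => simp
    | node l r => simp [minDepth] at ht
  simpa using Set.ncard_le_ncard this

theorem bad_succ (d h : ℕ) :
    Set.ncard {t : BTree | t.depth ≤ d + 1 ∧ t.minDepth ≤ h + 1} ≤
      1 + 2 * Set.ncard {t : BTree | t.depth ≤ d} *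
        Set.ncard {t : BTree | t.depth ≤ d ∧ t.minDepth ≤ h} := by
  have hf := finite_depth d
  have hg : {t : BTree | t.depth ≤ d ∧ t.minDepth ≤ h}.Finite :=
    hf.subset (fun t ht => ht.1)
  set f := (fun p : BTree × BTree => BTree.node p.1 p.2) with hfdef
  set S := {t : BTree | t.depth ≤ d} with hS
  set B := {t : BTree | t.depth ≤ d ∧ t.minDepth ≤ h} with hB
  have hsub : {t : BTree | t.depth ≤ d + 1 ∧ t.minDepth ≤ h + 1} ⊆
      {BTree.leaf} ∪ (Set.image f (B ×ˢ S) ∪ Set.image f (S ×ˢ B)) := by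
    intro t ht
    cases t with
    | leaf => simp
    | node l r =>
      simp [depth, minDepth] at ht
      simp [hfdef, hS, hB]
      tauto
  have h1 := Set.ncard_le_ncard hsub ((Set.finite_singleton _).union
    (((hg.prod hf).image f).union ((hf.prod hg).image f)))
  have h2 := Set.ncard_union_le {BTree.leaf} (Set.image f (B ×ˢ S) ∪ Set.image f (S ×ˢ B))
  have h3 := Set.ncard_union_le (Set.image f (B ×ˢ S)) (Set.image f (S ×ˢ B))
  rw [Set.ncard_image_of_injective _ node_injective,
    Set.ncard_image_of_injective _ node_injective, Set.ncard_prod, Set.ncard_prod] at h3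
  rw [Set.ncard_singleton] at h2
  nlinarith

theorem ncard_mono {a b : ℕ} (h : a ≤ b) : Set.ncard {t : BTree | t.depth ≤ a} ≤
    Set.ncard {t : BTree | t.depth ≤ b} :=
  Set.ncard_le_ncard (fun _ ht => le_trans ht h) (finite_depth b)

theorem bad_bound (d h : ℕ) :
    Set.ncard {t : BTree | t.depth ≤ d + h ∧ t.minDepth ≤ h} * Set.ncard {t : BTree | t.depth ≤ d}
      + Set.ncard {t : BTree | t.depth ≤ d + h}
      ≤ 2 ^ (h + 1) * Set.ncard {t : BTree | t.depth ≤ d + h} := by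
  induction h with
  | zero =>
    have := bad_zero d
    simp only [add_zero] at *
    have h2 := Nat.mul_le_mul_right (Set.ncard {t : BTree | t.depth ≤ d}) this
    rw [zero_add, pow_one]
    omega
  | succ h ih =>
    have h1 := bad_succ (d + h) h
    have h2 := ncard_succ (d + h)
    have h3 := ncard_mono (show d ≤ d + h + 1 by omega)
    rw [← add_assoc d h 1]
    generalize Set.ncard {t : BTree | t.depth ≤ d + h + 1 ∧ t.minDepth ≤ h + 1} = B1 at *
    generalize Set.ncard {t : BTree | t.depth ≤ d + h ∧ t.minDepth ≤ h} = B at *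
    generalize Set.ncard {t : BTree | t.depth ≤ d + h + 1} = N1 at *
    generalize Set.ncard {t : BTree | t.depth ≤ d + h} = N at *
    generalize Set.ncard {t : BTree | t.depth ≤ d} = M at *
    have hp : 1 ≤ 2 ^ (h + 1) := Nat.one_le_two_pow
    rw [pow_succ 2 (h + 1)]
    generalize 2 ^ (h + 1) = P at *
    have h4 : B1 * M ≤ (1 + 2 * N * B) * M := Nat.mul_le_mul_right _ h1
    have h5 : 2 * N * (B * M + N) ≤ 2 * N * (P * N) := Nat.mul_le_mul_left _ ih
    subst h2
    nlinarith

theorem ncard_lower (k : ℕ) : 2 ^ 2 ^ k ≤ Set.ncard {t : BTree | t.depth ≤ k + 1} := by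
  induction k with
  | zero => rw [ncard_succ, ncard_zero]; norm_num
  | succ k ih =>
    rw [ncard_succ, pow_succ 2 k, pow_mul]
    have := Nat.pow_le_pow_left ih 2
    omega

end BTree

/-- Let `T` be picked uniformly at random from the set of full binary
trees of depth at most `d`, where `d ≥ 1`. Then for any nonnegative integer
`h ≤ d - log₂ d - 2`, the probability that `T` has a leaf of depth at most `h` is at most
`2^{1 - 2^{d-h-2}}`. Equivalently (as stated here), the number of full binary trees of
depth at most `d` having some leaf of depth at most `h` is at most `2^{1 - 2^{d-h-2}} · N_d`,
where `N_d` is the total number of full binary trees of depth at most `d`. -/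
theorem random_binary_tree_shallow_leaf (d h : ℕ) (hd : 1 ≤ d)
    (hh : (h : ℝ) ≤ (d : ℝ) - Real.logb 2 d - 2) :
    (Set.ncard {t : BTree | t.depth ≤ d ∧ t.minDepth ≤ h} : ℝ)
      ≤ (2 : ℝ) ^ ((1 : ℤ) - 2 ^ (d - h - 2)) *
          Set.ncard {t : BTree | t.depth ≤ d} := by
  have hlog : 0 ≤ Real.logb 2 d := Real.logb_nonneg (by norm_num) (by exact_mod_cast hd)
  have hle : h + 2 ≤ d := by
    have : (h : ℝ) + 2 ≤ d := by linarith
    exact_mod_cast this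
  obtain ⟨m, rfl⟩ := Nat.exists_eq_add_of_le hle
  have hm : h + 2 + m ≤ 2 ^ m := by
    have h1 : Real.logb 2 ((h + 2 + m : ℕ) : ℝ) ≤ m := by
      push_cast at hh ⊢
      linarith
    rw [Real.logb_le_iff_le_rpow (by norm_num) (by positivity), Real.rpow_natCast] at h1
    exact_mod_cast h1
  have e1 : h + 2 + m - h - 2 = m := by omega
  have e2 : h + 2 + m = (m + 1 + 1) + h := by omega
  have hb := BTree.bad_bound (m + 1 + 1) h
  have hl := BTree.ncard_lower (m + 1)
  rw [e1]
  rw [← e2] at hb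
  generalize Set.ncard {t : BTree | t.depth ≤ h + 2 + m ∧ t.minDepth ≤ h} = B at *
  generalize Set.ncard {t : BTree | t.depth ≤ h + 2 + m} = N at *
  generalize Set.ncard {t : BTree | t.depth ≤ m + 1 + 1} = M at *
  have hq : 2 ^ h ≤ 2 ^ 2 ^ m := Nat.pow_le_pow_right (by norm_num) (by omega)
  have key : B * 2 ^ 2 ^ m ≤ 2 * N := by
    have a1 : B * 2 ^ 2 ^ (m + 1) ≤ 2 ^ (h + 1) * N :=
      le_trans (Nat.mul_le_mul_left _ hl) (le_trans (Nat.le_add_right _ _) hb)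
    rw [pow_succ 2 m, pow_mul, pow_succ 2 h] at a1
    have hpos : 0 < 2 ^ 2 ^ m := by positivity
    generalize 2 ^ 2 ^ m = Q at *
    have a2 : 2 ^ h * (2 * N) ≤ Q * (2 * N) := Nat.mul_le_mul_right _ hq
    refine le_of_mul_le_mul_left (a := Q) ?_ hpos
    nlinarith
  have e3 : (2 : ℝ) ^ ((1 : ℤ) - 2 ^ m) = 2 / 2 ^ 2 ^ m := by
    rw [zpow_sub₀ (by norm_num), zpow_one]
    congr 1
  rw [e3, div_mul_eq_mul_div, le_div_iff₀ (by positivity)]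
  exact_mod_cast key
end

section
/- Fix $n \ge d \ge 1$ and let $T$ be picked uniformly at random from the set of all non-redundant decision trees of depth at most $d$ on $n$ boolean variables (trees with different variable labels on internal vertices or different labels on leaves being counted as distinct). Then for any nonnegative integer $h \le d - \log_2 d - 2$, the probability that $T$ has a leaf of depth at most $h$ is at most $2^{1 - 2^{d-h-2}}$. -/
open Classical in
/-- The finset of trees of depth at most `d`, non-redundant from `s`. -/
noncomputable def treeSet (n : ℕ) : ℕ → Finset (Fin n) → Finset (DTree n Bool)
  | 0, _ => Finset.univ.image DTree.leaf
  | d + 1, s => Finset.univ.image DTree.leaf ∪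
      (Finset.univ.filter (· ∉ s)).biUnion fun i =>
        (treeSet n d (insert i s) ×ˢ treeSet n d (insert i s)).image
          fun p => DTree.node i p.1 p.2

theorem mem_treeSet {n : ℕ} (d : ℕ) (s : Finset (Fin n)) (t : DTree n Bool) :
    t ∈ treeSet n d s ↔ t.NonRedundantFrom s ∧ t.depth ≤ d := by
  classical
  induction d generalizing s t with
  | zero =>
    cases t with
    | leaf a => simp [treeSet, DTree.NonRedundantFrom, DTree.depth]
    | node i l r => simp [treeSet, DTree.depth]
  | succ d ih =>
    cases t with
    | leaf a => simp [treeSet, DTree.NonRedundantFrom, DTree.depth]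
    | node i l r =>
      simp [treeSet, DTree.NonRedundantFrom, DTree.depth, ih]
      tauto

theorem card_leaves (n : ℕ) [DecidableEq (DTree n Bool)] :
    ((Finset.univ : Finset Bool).image (DTree.leaf (n := n))).card = 2 := by
  rw [Finset.card_image_of_injective]
  · rfl
  · intro a b h
    injection h

theorem card_treeSet_succ {n : ℕ} (d : ℕ) (s : Finset (Fin n)) :
    (treeSet n (d + 1) s).card =
      2 + ∑ i ∈ Finset.univ.filter (· ∉ s), (treeSet n d (insert i s)).card ^ 2 := by
  classical
  rw [treeSet, Finset.card_union_of_disjoint, Finset.card_biUnion]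
  · rw [card_leaves]
    congr 1
    · refine Finset.sum_congr rfl fun i _ => ?_
      rw [Finset.card_image_of_injective, Finset.card_product, sq]
      rintro ⟨a, b⟩ ⟨c, e⟩ h
      simpa using h
  · intro i _ j _ hij
    rw [Function.onFun, Finset.disjoint_left]
    intro t h1 h2
    simp only [Finset.mem_image] at h1 h2
    obtain ⟨p, _, rfl⟩ := h1
    obtain ⟨q, _, hq⟩ := h2
    injection hq with h
    exact hij h.symm
  · rw [Finset.disjoint_left]
    intro t h1 h2
    simp only [Finset.mem_image, Finset.mem_biUnion] at h1 h2
    obtain ⟨a, _, rfl⟩ := h1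
    obtain ⟨i, _, q, _, hq⟩ := h2
    cases hq

theorem card_treeSet_ge {n : ℕ} (d : ℕ) (s : Finset (Fin n)) (h : s.card + d ≤ n) :
    2 ^ 2 ^ d ≤ (treeSet n d s).card := by
  classical
  induction d generalizing s with
  | zero =>
    have hl := card_leaves n
    rw [treeSet]
    exact le_of_eq (by convert hl.symm; norm_num)
  | succ d ih =>
    have : ∃ i, i ∉ s := by
      by_contra! hc
      have : s = Finset.univ := by ext i; simp [hc i]
      rw [this, Finset.card_univ, Fintype.card_fin] at h
      omega
    obtain ⟨i, hi⟩ := this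
    have h1 := ih (insert i s) (by rw [Finset.card_insert_of_notMem hi]; omega)
    rw [card_treeSet_succ]
    have h2 := Finset.single_le_sum
      (f := fun i => (treeSet n d (insert i s)).card ^ 2) (fun j _ => Nat.zero_le _)
      (show i ∈ Finset.univ.filter (· ∉ s) by simp [hi])
    have h3 := Nat.pow_le_pow_left h1 2
    rw [← pow_mul, ← pow_succ] at h3
    omega

open Classical in
/-- Trees with a shallow leaf. -/
noncomputable def badSet (n d h : ℕ) (s : Finset (Fin n)) : Finset (DTree n Bool) :=
  (treeSet n d s).filter (·.minDepth ≤ h)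

theorem card_badSet_zero {n : ℕ} (d : ℕ) (s : Finset (Fin n)) :
    (badSet n d 0 s).card ≤ 2 := by
  classical
  rw [← card_leaves n]
  apply Finset.card_le_card
  intro t ht
  simp only [badSet, Finset.mem_filter] at ht
  cases t with
  | leaf a => simp
  | node i l r => simp [DTree.minDepth] at ht

theorem card_badSet_succ {n : ℕ} (d h : ℕ) (s : Finset (Fin n)) :
    (badSet n (d + 1) (h + 1) s).card ≤
      2 + ∑ i ∈ Finset.univ.filter (· ∉ s),
        2 * ((badSet n d h (insert i s)).card * (treeSet n d (insert i s)).card) := by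
  classical
  have hsub : badSet n (d + 1) (h + 1) s ⊆ Finset.univ.image DTree.leaf ∪
      (Finset.univ.filter (· ∉ s)).biUnion fun i =>
        (badSet n d h (insert i s) ×ˢ treeSet n d (insert i s) ∪
          treeSet n d (insert i s) ×ˢ badSet n d h (insert i s)).image
          fun p => DTree.node i p.1 p.2 := by
    intro t ht
    simp only [badSet, Finset.mem_filter] at ht
    obtain ⟨h1, h2⟩ := ht
    cases t with
    | leaf a => simp
    | node i l r =>
      simp only [mem_treeSet, DTree.NonRedundantFrom, DTree.depth] at h1
      simp only [DTree.minDepth, Nat.add_le_add_iff_right, min_le_iff] at h2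
      simp [badSet, mem_treeSet]
      have h3 := h1.2
      simp at h3
      tauto
  refine (Finset.card_le_card hsub).trans ((Finset.card_union_le _ _).trans ?_)
  rw [card_leaves]
  refine Nat.add_le_add_left (Finset.card_biUnion_le.trans ?_) _
  refine Finset.sum_le_sum fun i _ => ?_
  refine Finset.card_image_le.trans ((Finset.card_union_le _ _).trans ?_)
  rw [Finset.card_product, Finset.card_product]
  exact le_of_eq (by ring)

theorem card_badSet_le {n : ℕ} (d h : ℕ) (s : Finset (Fin n)) (hs : s.card + d ≤ n)
    (hhd : h ≤ d) :
    ((badSet n d h s).card : ℝ) ≤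
      ((2 : ℝ) ^ (h + 2) - 2) / 2 ^ 2 ^ (d - h) * (treeSet n d s).card := by
  induction h generalizing d s with
  | zero =>
    have h1 : ((badSet n d 0 s).card : ℝ) ≤ 2 := by exact_mod_cast card_badSet_zero d s
    have h2 : ((2 : ℝ) ^ 2 ^ d) ≤ (treeSet n d s).card := by
      exact_mod_cast card_treeSet_ge d s hs
    refine h1.trans ?_
    rw [Nat.sub_zero, div_mul_eq_mul_div, le_div_iff₀ (by positivity)]
    norm_num
    exact h2
  | succ h ih =>
    obtain _ | d := d
    · omega
    have h1 : ((badSet n (d + 1) (h + 1) s).card : ℝ) ≤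
      2 + ∑ i ∈ Finset.univ.filter (· ∉ s),
        2 * (((badSet n d h (insert i s)).card : ℝ) * (treeSet n d (insert i s)).card) := by
      exact_mod_cast card_badSet_succ d h s
    have h2 : ((2 : ℝ) ^ 2 ^ (d + 1)) ≤ (treeSet n (d + 1) s).card := by
      exact_mod_cast card_treeSet_ge (d + 1) s hs
    have h3 : ((treeSet n (d + 1) s).card : ℝ) =
      2 + ∑ i ∈ Finset.univ.filter (· ∉ s), ((treeSet n d (insert i s)).card : ℝ) ^ 2 := by
      exact_mod_cast card_treeSet_succ d s
    rw [Nat.add_sub_add_right]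
    set c : ℝ := ((2 : ℝ) ^ (h + 2) - 2) / 2 ^ 2 ^ (d - h) with hc
    have hc0 : 0 ≤ c := by
      apply div_nonneg _ (by positivity)
      have : (1 : ℝ) ≤ 2 ^ h := one_le_pow₀ (by norm_num)
      rw [pow_add]; linarith
    have h4 : ∑ i ∈ Finset.univ.filter (· ∉ s),
        2 * (((badSet n d h (insert i s)).card : ℝ) * (treeSet n d (insert i s)).card) ≤
        2 * c * ∑ i ∈ Finset.univ.filter (· ∉ s), ((treeSet n d (insert i s)).card : ℝ) ^ 2 := by
      rw [Finset.mul_sum]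
      refine Finset.sum_le_sum fun i hi => ?_
      have hi' : i ∉ s := by simpa using hi
      have := ih d (insert i s) (by rw [Finset.card_insert_of_notMem hi']; omega) (by omega)
      have := mul_le_mul_of_nonneg_right this
        (Nat.cast_nonneg (α := ℝ) (treeSet n d (insert i s)).card)
      linarith
    have h5 : (2 : ℝ) ≤ 2 / 2 ^ 2 ^ (d - h) * (treeSet n (d + 1) s).card := by
      rw [div_mul_eq_mul_div, le_div_iff₀ (by positivity)]
      have : (2 : ℝ) ^ 2 ^ (d - h) ≤ 2 ^ 2 ^ (d + 1) := by
        apply pow_le_pow_right₀ (by norm_num)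
        apply Nat.pow_le_pow_right (by norm_num)
        omega
      linarith
    have h6 : ((2 : ℝ) ^ (h + 1 + 2) - 2) / 2 ^ 2 ^ (d - h) = 2 / 2 ^ 2 ^ (d - h) + 2 * c := by
      rw [hc, pow_succ _ (h + 2)]
      ring
    rw [h6, add_mul]
    nlinarith

/-- Fix `n ≥ d ≥ 1` and let `T` be picked uniformly at random from the
set of all non-redundant decision trees of depth at most `d` on `n` boolean variables
(trees with different variable labels on internal vertices or different labels on leaves
being counted as distinct). Then for any nonnegative integer `h ≤ d - log₂ d - 2`, the
probability that `T` has a leaf of depth at most `h` is at most `2^{1 - 2^{d-h-2}}`. -/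
theorem random_decision_tree_shallow_leaf (n d h : ℕ) (hnd : d ≤ n) (hd : 1 ≤ d)
    (hh : (h : ℝ) ≤ (d : ℝ) - Real.logb 2 d - 2) :
    (Set.ncard {t : DTree n Bool |
        t.NonRedundant ∧ t.depth ≤ d ∧ t.minDepth ≤ h} : ℝ) /
      Set.ncard {t : DTree n Bool | t.NonRedundant ∧ t.depth ≤ d}
      ≤ (2 : ℝ) ^ ((1 : ℤ) - 2 ^ (d - h - 2)) := by
  have e1 : {t : DTree n Bool | t.NonRedundant ∧ t.depth ≤ d ∧ t.minDepth ≤ h} =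
      (badSet n d h ∅ : Set (DTree n Bool)) := by
    ext t
    simp [badSet, mem_treeSet, DTree.NonRedundant, and_assoc]
  have e2 : {t : DTree n Bool | t.NonRedundant ∧ t.depth ≤ d} =
      (treeSet n d ∅ : Set (DTree n Bool)) := by
    ext t
    simp [mem_treeSet, DTree.NonRedundant]
  rw [e1, e2, Set.ncard_coe_finset, Set.ncard_coe_finset]
  have hlog : 0 ≤ Real.logb 2 d :=
    Real.logb_nonneg (by norm_num) (by exact_mod_cast hd)
  have hhd : h + 2 ≤ d := by
    have : (h : ℝ) + 2 ≤ d := by linarith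
    exact_mod_cast this
  obtain ⟨k, rfl⟩ := Nat.exists_eq_add_of_le hhd
  have hk : h + 2 + k ≤ 2 ^ k := by
    have h1 : Real.logb 2 ((h + 2 + k : ℕ) : ℝ) ≤ k := by
      push_cast at hh ⊢
      linarith
    rw [Real.logb_le_iff_le_rpow (by norm_num) (by positivity), Real.rpow_natCast] at h1
    exact_mod_cast h1
  have hpos : (0 : ℝ) < (treeSet n (h + 2 + k) ∅).card := by
    have := card_treeSet_ge (n := n) (h + 2 + k) ∅ (by simpa using hnd)
    have h0 : 0 < 2 ^ 2 ^ (h + 2 + k) := by positivity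
    exact_mod_cast h0.trans_le this
  rw [div_le_iff₀ hpos]
  refine (card_badSet_le (n := n) (h + 2 + k) h ∅ (by simpa using hnd) (by omega)).trans ?_
  refine mul_le_mul_of_nonneg_right ?_ hpos.le
  rw [show h + 2 + k - h = k + 2 by omega, Nat.add_sub_cancel]
  rw [show ((1 : ℤ) - 2 ^ k) = ((1 : ℕ) : ℤ) - ((2 ^ k : ℕ) : ℤ) by push_cast; rfl,
    zpow_sub₀ (by norm_num), zpow_natCast, zpow_natCast,
    div_le_div_iff₀ (by positivity) (by positivity)]
  have h7 : ((2 : ℝ) ^ (h + 2) - 2) * 2 ^ 2 ^ k ≤ 2 ^ (h + 2) * 2 ^ 2 ^ k :=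
    mul_le_mul_of_nonneg_right (by linarith) (by positivity)
  refine h7.trans ?_
  rw [← pow_add, ← pow_add]
  apply pow_le_pow_right₀ (by norm_num)
  rw [pow_add 2 k 2]
  omega
end

section
/- Let $T$ be a non-redundant decision tree structure of depth at most $d$ on $n$ boolean variables, with leaf set $\mathcal{L}$ of size $L$, such that every leaf of $T$ has depth at least $2d/3$. Then $\mathbb{E}_{z \in \{0,1\}^L}[\bar{s}(T_z)] \ge d/3$, where $z$ is uniform. -/
namespace DTree

variable {n : ℕ} {α β : Type}

theorem eval_map_aux (t : DTree n α) (f : α → β) (x : Fin n → Bool) :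
    (t.map f).eval x = f (t.eval x) := by
  induction t with
  | leaf a => rfl
  | node i l r ihl ihr =>
    simp only [map, eval]
    split <;> assumption

theorem eval_mem_leaves_aux (t : DTree n α) (x : Fin n → Bool) : t.eval x ∈ t.leaves := by
  induction t with
  | leaf a => simp [eval, leaves]
  | node i l r ihl ihr =>
    simp only [leaves, eval, List.mem_append]
    split
    · right; assumption
    · left; assumption

theorem depthOf_eval_aux [DecidableEq α] (t : DTree n α) (x : Fin n → Bool)
    (h : t.leaves.Nodup) : t.depthOf (t.eval x) = t.pathLen x := by
  induction t with
  | leaf a => rfl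
  | node i l r ihl ihr =>
    simp only [leaves, List.nodup_append'] at h
    obtain ⟨hl, hr, hd⟩ := h
    simp only [depthOf, eval, pathLen]
    by_cases hx : x i
    · have : r.eval x ∉ l.leaves := fun h' => hd h' (eval_mem_leaves_aux r x)
      simp [hx, this, ihr hr]
    · simp [hx, eval_mem_leaves_aux l x, ihl hl]

theorem eval_flip_ne_aux (t : DTree n α) (x : Fin n → Bool) (i : Fin n)
    (h : t.leaves.Nodup) (hq : t.Queries x i) : t.eval x ≠ t.eval (flipBit x i) := by
  induction t with
  | leaf a => exact hq.elim
  | node j l r ihl ihr =>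
    simp only [leaves, List.nodup_append'] at h
    obtain ⟨hl, hr, hd⟩ := h
    simp only [Queries] at hq
    by_cases hji : j = i
    · subst hji
      have hf : flipBit x j j = !x j := by simp [flipBit]
      simp only [eval, hf]
      by_cases hx : x j
      · simp only [hx]
        intro h'
        simp at h'
        exact hd (eval_mem_leaves_aux l _) (h' ▸ eval_mem_leaves_aux r x)
      · simp only [hx]
        intro h'
        simp at h'
        exact hd (eval_mem_leaves_aux l x) (h' ▸ eval_mem_leaves_aux r _)
    · have hf : flipBit x i j = x j := by simp [flipBit, hji]
      simp only [eval, hf]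
      simp only [hji, false_or] at hq
      by_cases hx : x j
      · simp only [hx, if_true] at hq ⊢
        exact ihr hr hq
      · simp only [hx] at hq ⊢
        simp at hq ⊢
        exact ihl hl hq

theorem exists_queries_aux (t : DTree n α) (x : Fin n → Bool) (s : Finset (Fin n))
    (h : t.NonRedundantFrom s) :
    ∃ Q : Finset (Fin n), Disjoint Q s ∧ Q.card = t.pathLen x ∧ ∀ i ∈ Q, t.Queries x i := by
  induction t generalizing s with
  | leaf a => exact ⟨∅, by simp, by simp [pathLen], by simp⟩
  | node j l r ihl ihr =>
    obtain ⟨hj, hl, hr⟩ := h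
    have key : ∃ Q : Finset (Fin n), Disjoint Q (insert j s) ∧
        Q.card = (if x j then r.pathLen x else l.pathLen x) ∧
        ∀ i ∈ Q, (if x j then r.Queries x i else l.Queries x i) := by
      by_cases hx : x j
      · simpa [hx] using ihr _ hr
      · simpa [hx] using ihl _ hl
    obtain ⟨Q, hd, hc, hq⟩ := key
    rw [Finset.disjoint_insert_right] at hd
    refine ⟨insert j Q, ?_, ?_, ?_⟩
    · rw [Finset.disjoint_insert_left]; exact ⟨hj, hd.2⟩
    · rw [Finset.card_insert_of_notMem hd.1, hc]; rfl
    · intro i hi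
      rcases Finset.mem_insert.1 hi with rfl | hi
      · exact Or.inl rfl
      · exact Or.inr (hq i hi)

end DTree

theorem sum_abs_aux {L : ℕ} (a b : Fin L) (hab : a ≠ b) :
    ∑ z : Fin L → Bool, |b2r (z a) - b2r (z b)| = (2 : ℝ) ^ L / 2 := by
  have hinv : Function.Involutive (fun z : Fin L → Bool => flipBit z a) := by
    intro z
    funext k
    by_cases hk : k = a
    · subst hk; simp [flipBit]
    · simp [flipBit, hk]
  have h1 : ∑ z : Fin L → Bool, |b2r (z a) - b2r (z b)|
      = ∑ z : Fin L → Bool, |b2r (flipBit z a a) - b2r (flipBit z a b)| :=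
    (Equiv.sum_comp hinv.toPerm (fun z : Fin L → Bool => |b2r (z a) - b2r (z b)|)).symm
  have h2 : ∑ z : Fin L → Bool, (|b2r (z a) - b2r (z b)|
      + |b2r (flipBit z a a) - b2r (flipBit z a b)|) = (2 : ℝ) ^ L := by
    have : ∀ z : Fin L → Bool, |b2r (z a) - b2r (z b)|
      + |b2r (flipBit z a a) - b2r (flipBit z a b)| = 1 := by
      intro z
      have e1 : flipBit z a a = !z a := by simp [flipBit]
      have e2 : flipBit z a b = z b := by simp [flipBit, hab.symm]
      rw [e1, e2]
      cases z a <;> cases z b <;> simp [b2r]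
    simp [this]
  rw [Finset.sum_add_distrib, ← h1] at h2
  linarith

/-- Let `T` be a non-redundant decision tree structure of depth at most
`d` on `n` boolean variables, with leaf set indexed by `Fin L` (each index occurring at
exactly one leaf), such that every leaf of `T` has depth at least `2d/3`. Then
`E_{z ∈ {0,1}^L}[s̄(T_z)] ≥ d/3`, where `z` is uniform. -/
theorem expected_avgSens_lower_bound (n L d : ℕ) (t : DTree n (Fin L))
    (ht : t.NonRedundant) (hnodup : t.leaves.Nodup)
    (hsurj : ∀ j : Fin L, j ∈ t.leaves)
    (hdepth : t.depth ≤ d)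
    (hleaf : ∀ ℓ : Fin L, (2 * d : ℝ) / 3 ≤ (t.depthOf ℓ : ℝ)) :
    (d : ℝ) / 3 ≤ (∑ z : Fin L → Bool, avgSens (fun x => (t.map z).eval x)) / 2 ^ L := by
  have hx : ∀ x : Fin n → Bool, (d : ℝ) / 3 * 2 ^ L ≤
      ∑ i : Fin n, ∑ z : Fin L → Bool, |b2r (z (t.eval x)) - b2r (z (t.eval (flipBit x i)))| := by
    intro x
    obtain ⟨Q, -, hc, hq⟩ := t.exists_queries_aux x ∅ ht
    have h1 := hleaf (t.eval x)
    rw [t.depthOf_eval_aux x hnodup, ← hc] at h1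
    calc (d : ℝ) / 3 * 2 ^ L = (2 * d : ℝ) / 3 * (2 ^ L / 2) := by ring
      _ ≤ (Q.card : ℝ) * (2 ^ L / 2) := by gcongr
      _ = ∑ i ∈ Q, ∑ z : Fin L → Bool,
            |b2r (z (t.eval x)) - b2r (z (t.eval (flipBit x i)))| := by
          rw [Finset.sum_congr rfl (fun i hi =>
            sum_abs_aux _ _ (t.eval_flip_ne_aux x i hnodup (hq i hi)))]
          simp
      _ ≤ _ := Finset.sum_le_sum_of_subset_of_nonneg (Finset.subset_univ _)
          (fun _ _ _ => Finset.sum_nonneg fun _ _ => abs_nonneg _)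
  have hsum := Finset.sum_le_sum (fun x (_ : x ∈ (Finset.univ : Finset (Fin n → Bool))) => hx x)
  simp only [avgSens, DTree.eval_map_aux]
  rw [← Finset.sum_div, Finset.sum_comm]
  rw [le_div_iff₀ (by positivity), le_div_iff₀ (by positivity)]
  rw [Finset.sum_congr rfl (fun x _ => Finset.sum_comm)]
  simp at hsum
  linarith
end

section
/- Fix $n \ge d$ with $d/3 \ge \log_2 d + 2$, and let $T$ be picked uniformly at random from the set of all non-redundant decision trees of depth at most $d$ on $n$ boolean variables (trees with different variable labels on internal vertices or different labels on leaves being counted as distinct). Then for every $\epsilon$ with $0 < \epsilon < 1$, $\Pr_T[\, \bar{s}(T) < (1-\epsilon) d/3 \,] \le 2^{1 - 2^{d/3 - 2}} + e^{-2^{d/3 - 3} \epsilon^2}$, where $\bar{s}(T)$ denotes the average sensitivity of the boolean function computed by $T$. -/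
namespace RDT

open DTree

variable {n : ℕ}

/-- The shape of a labelled tree. -/
def shp (t : DTree n Bool) : DTree n Unit := t.map (fun _ => ())

/-- Expectation over uniformly random leaf labels. -/
noncomputable def Ex : DTree n Unit → (DTree n Bool → ℝ) → ℝ
  | .leaf _, F => (F (.leaf false) + F (.leaf true)) / 2
  | .node i l r, F => Ex l (fun a => Ex r (fun b => F (.node i a b)))

lemma Ex_mono (S : DTree n Unit) : ∀ (F G : DTree n Bool → ℝ),
    (∀ t, shp t = S → F t ≤ G t) → Ex S F ≤ Ex S G := by
  induction S with
  | leaf u =>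
    intro F G h
    have h0 := h (.leaf false) rfl
    have h1 := h (.leaf true) rfl
    simp only [Ex]; linarith
  | node i l r ihl ihr =>
    intro F G h
    simp only [Ex]
    refine ihl _ _ fun a ha => ihr _ _ fun b hb => h _ ?_
    simp only [shp, DTree.map] at *
    rw [ha, hb]

lemma Ex_congr (S : DTree n Unit) (F G : DTree n Bool → ℝ)
    (h : ∀ t, shp t = S → F t = G t) : Ex S F = Ex S G :=
  le_antisymm (Ex_mono S _ _ fun t ht => (h t ht).le) (Ex_mono S _ _ fun t ht => (h t ht).ge)

lemma Ex_add (S : DTree n Unit) : ∀ (F G : DTree n Bool → ℝ),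
    Ex S (fun t => F t + G t) = Ex S F + Ex S G := by
  induction S with
  | leaf u => intro F G; simp only [Ex]; ring
  | node i l r ihl ihr => intro F G; simp only [Ex, ihr, ihl]

lemma Ex_mul (S : DTree n Unit) : ∀ (c : ℝ) (F : DTree n Bool → ℝ),
    Ex S (fun t => c * F t) = c * Ex S F := by
  induction S with
  | leaf u => intro c F; simp only [Ex]; ring
  | node i l r ihl ihr => intro c F; simp only [Ex, ihr, ihl]

lemma Ex_const (S : DTree n Unit) : ∀ (c : ℝ), Ex S (fun _ => c) = c := by
  induction S with
  | leaf u => intro c; simp only [Ex]; ring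
  | node i l r ihl ihr => intro c; simp only [Ex, ihr, ihl]

lemma Ex_sum (S : DTree n Unit) {ι : Type*} (A : Finset ι) (F : ι → DTree n Bool → ℝ) :
    Ex S (fun t => ∑ x ∈ A, F x t) = ∑ x ∈ A, Ex S (F x) := by
  classical
  induction A using Finset.induction_on with
  | empty => simp [Ex_const]
  | insert a A ha ih => simp only [Finset.sum_insert ha, Ex_add, ih]

/-- Average over the cube. -/
noncomputable def av (g : (Fin n → Bool) → ℝ) : ℝ := (∑ x, g x) / 2 ^ n

lemma flip_flip (x : Fin n → Bool) (i : Fin n) : flipBit (flipBit x i) i = x := by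
  simp [flipBit]

lemma sum_flip (i : Fin n) (g : (Fin n → Bool) → ℝ) : ∑ x, g (flipBit x i) = ∑ x, g x :=
  Equiv.sum_comp (Function.Involutive.toPerm (fun x => flipBit x i) (fun x => flip_flip x i)) g

lemma av_ite (i : Fin n) (g h : (Fin n → Bool) → ℝ)
    (hg : ∀ x, g (flipBit x i) = g x) (hh : ∀ x, h (flipBit x i) = h x) :
    av (fun x => if x i then g x else h x) = (av g + av h) / 2 := by
  have key : 2 * ∑ x : Fin n → Bool, (if x i then g x else h x) = ∑ x, g x + ∑ x, h x := by
    rw [two_mul]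
    nth_rewrite 2 [← sum_flip i]
    rw [← Finset.sum_add_distrib, ← Finset.sum_add_distrib]
    refine Finset.sum_congr rfl fun x _ => ?_
    rw [hg, hh]
    cases hx : x i <;> simp [flipBit, hx, add_comm]
  simp only [av]
  rw [← add_div, ← key]; ring

lemma av_mono (g h : (Fin n → Bool) → ℝ) (H : ∀ x, g x ≤ h x) : av g ≤ av h := by
  unfold av
  gcongr with x
  exact H x

lemma av_add (g h : (Fin n → Bool) → ℝ) : av (fun x => g x + h x) = av g + av h := by
  simp only [av, Finset.sum_add_distrib, add_div]

lemma av_const (c : ℝ) : av (fun _ : Fin n → Bool => c) = c := by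
  simp [av]

lemma Ex_av (S : DTree n Unit) (F : (Fin n → Bool) → DTree n Bool → ℝ) :
    Ex S (fun t => av (fun x => F x t)) = av (fun x => Ex S (F x)) := by
  simp only [av, div_eq_inv_mul, Ex_mul, Ex_sum]

lemma eval_flip (t : DTree n Bool) : ∀ (s : Finset (Fin n)) (i : Fin n), i ∈ s →
    t.NonRedundantFrom s → ∀ x, t.eval (flipBit x i) = t.eval x := by
  induction t with
  | leaf a => intros; rfl
  | node j l r ihl ihr =>
    intro s i his h x
    obtain ⟨hj, hl, hr⟩ := h
    have hij : j ≠ i := fun h => hj (h ▸ his)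
    have e : flipBit x i j = x j := by simp [flipBit, hij]
    simp only [DTree.eval, e, ihl _ i (Finset.mem_insert_of_mem his) hl x,
      ihr _ i (Finset.mem_insert_of_mem his) hr x]

/-- evaluation as a real number -/
noncomputable def ev (t : DTree n Bool) (x : Fin n → Bool) : ℝ := b2r (t.eval x)

lemma ev_node (i : Fin n) (l r : DTree n Bool) (x) :
    ev (.node i l r) x = if x i then ev r x else ev l x := by
  simp only [ev, DTree.eval]; split_ifs <;> rfl

lemma ev_flip {t : DTree n Bool} {s : Finset (Fin n)} {i : Fin n} (his : i ∈ s)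
    (h : t.NonRedundantFrom s) (x) : ev t (flipBit x i) = ev t x := by
  simp only [ev, eval_flip t s i his h x]

/-- average sensitivity of a tree -/
noncomputable def sens (t : DTree n Bool) : ℝ := avgSens (fun x => t.eval x)

lemma sens_eq (t : DTree n Bool) :
    sens t = ∑ j, av (fun x => |ev t x - ev t (flipBit x j)|) := by
  simp only [sens, avgSens, av, ev]
  rw [Finset.sum_comm, Finset.sum_div]

/-- distance of trees -/
noncomputable def dist (t u : DTree n Bool) : ℝ := av (fun x => |ev t x - ev u x|)

lemma flip_comm (x : Fin n → Bool) (i j : Fin n) :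
    flipBit (flipBit x i) j = flipBit (flipBit x j) i := by
  by_cases h : i = j
  · subst h; rfl
  · funext k
    simp only [flipBit, Function.update_apply]
    have h' : j ≠ i := fun e => h e.symm
    by_cases h1 : k = i <;> by_cases h2 : k = j <;> simp_all

lemma sens_node (i : Fin n) (l r : DTree n Bool) (s : Finset (Fin n)) (his : i ∈ s)
    (hl : l.NonRedundantFrom s) (hr : r.NonRedundantFrom s) :
    sens (.node i l r) = (sens l + sens r) / 2 + dist l r := by
  have key : ∀ j, av (fun x => |ev (.node i l r) x - ev (.node i l r) (flipBit x j)|)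
      = (av (fun x => |ev l x - ev l (flipBit x j)|)
        + av (fun x => |ev r x - ev r (flipBit x j)|)) / 2 + if j = i then dist l r else 0 := by
    intro j
    by_cases hji : j = i
    · subst hji
      have e1 : ∀ x, |ev l x - ev l (flipBit x j)| = 0 := by
        intro x; rw [ev_flip his hl]; simp
      have e2 : ∀ x, |ev r x - ev r (flipBit x j)| = 0 := by
        intro x; rw [ev_flip his hr]; simp
      simp only [e1, e2, av_const, if_true, dist]
      simp only [add_zero, zero_div, zero_add]
      congr 1; funext x
      rw [ev_node, ev_node, ev_flip his hl, ev_flip his hr]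
      cases hx : x j <;> simp [flipBit, hx, abs_sub_comm]
    · rw [if_neg hji, add_zero, add_comm (av _), ← av_ite i]
      · congr 1; funext x
        rw [ev_node, ev_node]
        have : flipBit x j i = x i := by simp [flipBit, Ne.symm hji]
        rw [this]
        split_ifs <;> rfl
      · intro x; rw [flip_comm, ev_flip his hr, ev_flip his hr]
      · intro x; rw [flip_comm, ev_flip his hl, ev_flip his hl]
  rw [sens_eq, sens_eq, sens_eq, Finset.sum_congr rfl fun j _ => key j, Finset.sum_add_distrib,
    ← Finset.sum_div, Finset.sum_add_distrib]
  simp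

lemma dist_node (i : Fin n) (l r l' r' : DTree n Bool) (s : Finset (Fin n)) (his : i ∈ s)
    (hl : l.NonRedundantFrom s) (hr : r.NonRedundantFrom s)
    (hl' : l'.NonRedundantFrom s) (hr' : r'.NonRedundantFrom s) :
    dist (.node i l r) (.node i l' r') = (dist l l' + dist r r') / 2 := by
  unfold dist
  rw [add_comm (av _), ← av_ite i]
  · congr 1; funext x
    rw [ev_node, ev_node]
    split_ifs <;> rfl
  · intro x; rw [ev_flip his hr, ev_flip his hr']
  · intro x; rw [ev_flip his hl, ev_flip his hl']

lemma dist_nonneg (t u : DTree n Bool) : 0 ≤ dist t u := by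
  rw [← av_const (n := n) 0]
  exact av_mono _ _ fun x => abs_nonneg _

lemma dist_comm (t u : DTree n Bool) : dist t u = dist u t := by
  simp only [dist, abs_sub_comm]

lemma dist_self (t : DTree n Bool) : dist t t = 0 := by
  simp [dist, av_const]

lemma dist_tri (t u v : DTree n Bool) : dist t v ≤ dist t u + dist u v := by
  unfold dist
  rw [← av_add]
  exact av_mono _ _ fun x => abs_sub_le _ _ _

lemma nonred_shp (t : DTree n Bool) : ∀ s, (shp t).NonRedundantFrom s ↔ t.NonRedundantFrom s := by
  induction t with
  | leaf a => intro s; simp [shp, DTree.map, NonRedundantFrom]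
  | node i l r ihl ihr =>
    intro s
    simp only [shp] at ihl ihr
    simp only [shp, DTree.map, NonRedundantFrom, ihl, ihr]

lemma minDepth_shp (t : DTree n Bool) : (shp t).minDepth = t.minDepth := by
  induction t with
  | leaf a => rfl
  | node i l r ihl ihr =>
    simp only [shp] at ihl ihr
    simp only [shp, DTree.map, minDepth, ihl, ihr]

lemma depth_shp (t : DTree n Bool) : (shp t).depth = t.depth := by
  induction t with
  | leaf a => rfl
  | node i l r ihl ihr =>
    simp only [shp] at ihl ihr
    simp only [shp, DTree.map, depth, ihl, ihr]

lemma shp_leaf_iff (t : DTree n Bool) (u : Unit) : shp t = .leaf u ↔ ∃ b, t = .leaf b := by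
  cases t <;> simp [shp, DTree.map]

lemma shp_node_iff (t : DTree n Bool) (i) (l r : DTree n Unit) :
    shp t = .node i l r ↔ ∃ a b, t = .node i a b ∧ shp a = l ∧ shp b = r := by
  cases t with
  | leaf => simp [shp, DTree.map]
  | node j a b =>
    simp only [shp, DTree.map, node.injEq]
    constructor
    · rintro ⟨rfl, rfl, rfl⟩; exact ⟨a, b, ⟨rfl, rfl, rfl⟩, rfl, rfl⟩
    · rintro ⟨a', b', ⟨rfl, rfl, rfl⟩, rfl, rfl⟩; exact ⟨rfl, rfl, rfl⟩

lemma sens_leaf (b : Bool) : sens (.leaf b : DTree n Bool) = 0 := by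
  rw [sens_eq]; simp [ev, DTree.eval, av_const]

lemma sens_lip (S : DTree n Unit) : ∀ (s : Finset (Fin n)) (_ : S.NonRedundantFrom s) (t u),
    shp t = S → shp u = S → |sens t - sens u| ≤ 2 * S.depth * dist t u := by
  induction S with
  | leaf v =>
    intro s _ t u ht hu
    obtain ⟨b, rfl⟩ := (shp_leaf_iff _ _).1 ht
    obtain ⟨c, rfl⟩ := (shp_leaf_iff _ _).1 hu
    simp [sens_leaf, depth]
  | node i l r ihl ihr =>
    intro s hS t u ht hu
    obtain ⟨a, b, rfl, rfl, rfl⟩ := (shp_node_iff _ _ _ _).1 ht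
    obtain ⟨a', b', rfl, ha, hb⟩ := (shp_node_iff _ _ _ _).1 hu
    obtain ⟨hi, hl, hr⟩ := hS
    have Hl := ihl _ hl a a' rfl ha
    have Hr := ihr _ hr b b' rfl hb
    have na := (nonred_shp a _).1 hl
    have nb := (nonred_shp b _).1 hr
    have na' := (nonred_shp a' _).1 (ha ▸ hl)
    have nb' := (nonred_shp b' _).1 (hb ▸ hr)
    have his := Finset.mem_insert_self i s
    rw [sens_node i a b _ his na nb, sens_node i a' b' _ his na' nb',
      dist_node i a b a' b' _ his na nb na' nb']
    have d1 := dist_tri a a' b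
    have d2 := dist_tri a' b' b
    have d3 := dist_tri a' a b'
    have d4 := dist_tri a b b'
    rw [dist_comm b' b] at d2
    rw [dist_comm a' a] at d3
    have p1 := dist_nonneg a a'
    have p2 := dist_nonneg b b'
    simp only [depth]
    push_cast
    set D : ℝ := max ((shp a).depth : ℝ) ((shp b).depth : ℝ)
    have D1 : ((shp a).depth : ℝ) * dist a a' ≤ D * dist a a' := by
      gcongr; exact le_max_left _ _
    have D2 : ((shp b).depth : ℝ) * dist b b' ≤ D * dist b b' := by
      gcongr; exact le_max_right _ _
    rw [abs_le] at *
    constructor <;> nlinarith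

lemma Ex_ev (S : DTree n Unit) : ∀ (c : Bool) (x : Fin n → Bool),
    Ex S (fun t => |b2r c - ev t x|) = 1 / 2 := by
  induction S with
  | leaf u => intro c x; cases c <;> simp [Ex, ev, DTree.eval, b2r]
  | node i l r ihl ihr =>
    intro c x
    simp only [Ex, ev_node]
    cases hx : x i
    · simp [Ex_const, ihl c x]
    · simp [Ex_const, ihr c x]

lemma Ex_dist (S : DTree n Unit) (a : DTree n Bool) : Ex S (fun b => dist a b) = 1 / 2 := by
  unfold dist
  rw [Ex_av]
  simp only [ev]
  have := fun x => Ex_ev S (a.eval x) x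
  simp only [ev] at this
  simp only [this, av_const]

lemma Ex_sens (S : DTree n Unit) : ∀ (s : Finset (Fin n)) (_ : S.NonRedundantFrom s),
    (S.minDepth : ℝ) / 2 ≤ Ex S sens := by
  induction S with
  | leaf u => intro s _; simp [Ex, sens_leaf, minDepth]
  | node i l r ihl ihr =>
    intro s ⟨hi, hl, hr⟩
    have Hl := ihl _ hl
    have Hr := ihr _ hr
    have e : Ex (.node i l r) sens = (Ex l sens + Ex r sens) / 2 + 1 / 2 := by
      have : Ex (.node i l r) sens
          = Ex l (fun a => Ex r (fun b => (1/2 * sens a + 1/2 * sens b) + dist a b)) := by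
        simp only [Ex]
        refine Ex_congr _ _ _ fun a ha => Ex_congr _ _ _ fun b hb => ?_
        rw [sens_node i a b _ (Finset.mem_insert_self i s) ((nonred_shp a _).1 (ha ▸ hl))
          ((nonred_shp b _).1 (hb ▸ hr))]
        ring
      rw [this]
      simp only [Ex_add, Ex_dist, Ex_mul, Ex_const]
      ring
    rw [e]
    simp only [minDepth]
    push_cast
    have m1 := min_le_left (l.minDepth : ℝ) r.minDepth
    have m2 := min_le_right (l.minDepth : ℝ) r.minDepth
    linarith

/-- Sum over leaves of `4 ^ (-depth)`. -/
noncomputable def V : DTree n Unit → ℝ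
  | .leaf _ => 1
  | .node _ l r => (V l + V r) / 4

lemma V_le (S : DTree n Unit) : V S ≤ (1 / 2) ^ S.minDepth := by
  induction S with
  | leaf u => simp [V, minDepth]
  | node i l r ihl ihr =>
    simp only [V, minDepth, pow_succ]
    have h1 : ((1:ℝ) / 2) ^ l.minDepth ≤ (1 / 2) ^ (min l.minDepth r.minDepth) :=
      pow_le_pow_of_le_one (by norm_num) (by norm_num) (min_le_left _ _)
    have h2 : ((1:ℝ) / 2) ^ r.minDepth ≤ (1 / 2) ^ (min l.minDepth r.minDepth) :=
      pow_le_pow_of_le_one (by norm_num) (by norm_num) (min_le_right _ _)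
    linarith

lemma mcd (S : DTree n Unit) : ∀ (s : Finset (Fin n)) (_ : S.NonRedundantFrom s) (K lam : ℝ)
    (F : DTree n Bool → ℝ)
    (_ : ∀ t u, shp t = S → shp u = S → |F t - F u| ≤ K * dist t u),
    Ex S (fun t => Real.exp (lam * F t))
      ≤ Real.exp (lam * Ex S F + lam ^ 2 * K ^ 2 * V S / 8) := by
  induction S with
  | leaf v =>
    intro s _ K lam F hF
    have h := hF (.leaf false) (.leaf true) rfl rfl
    have hd : dist (.leaf false : DTree n Bool) (.leaf true) = 1 := by
      simp [dist, ev, DTree.eval, b2r, av_const]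
    rw [hd, mul_one] at h
    simp only [Ex, V]
    set p := F (.leaf false)
    set q := F (.leaf true)
    have hc := Real.cosh_le_exp_half_sq (lam * ((p - q) / 2))
    have e1 : (Real.exp (lam * p) + Real.exp (lam * q)) / 2
        = Real.exp (lam * ((p + q) / 2)) * Real.cosh (lam * ((p - q) / 2)) := by
      rw [Real.cosh_eq, mul_div_assoc', mul_add, ← Real.exp_add, ← Real.exp_add]
      ring_nf
    rw [e1, Real.exp_add]
    refine mul_le_mul_of_nonneg_left (hc.trans (Real.exp_le_exp.2 ?_)) (Real.exp_pos _).le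
    have h2 : (p - q) ^ 2 ≤ K ^ 2 := by
      rw [← sq_abs]; exact pow_le_pow_left₀ (abs_nonneg _) h 2
    have := mul_le_mul_of_nonneg_left h2 (sq_nonneg lam)
    nlinarith
  | node i l r ihl ihr =>
    intro s ⟨hi, hl, hr⟩ K lam F hF
    have his := Finset.mem_insert_self i s
    have na := fun a (ha : shp a = l) => (nonred_shp a _).1 (ha ▸ hl)
    have nb := fun b (hb : shp b = r) => (nonred_shp b _).1 (hb ▸ hr)
    have sh : ∀ a b, shp a = l → shp b = r → shp (.node i a b) = .node i l r := by
      intro a b ha hb; exact (shp_node_iff _ _ _ _).2 ⟨a, b, rfl, ha, hb⟩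
    have L1 : ∀ b, shp b = r → ∀ t u, shp t = l → shp u = l →
        |F (.node i t b) - F (.node i u b)| ≤ K / 2 * dist t u := by
      intro b hb t u ht hu
      refine (hF _ _ (sh t b ht hb) (sh u b hu hb)).trans_eq ?_
      rw [dist_node i _ _ _ _ _ his (na t ht) (nb b hb) (na u hu) (nb b hb), dist_self]; ring
    have L2 : ∀ a, shp a = l → ∀ t u, shp t = r → shp u = r →
        |F (.node i a t) - F (.node i a u)| ≤ K / 2 * dist t u := by
      intro a ha t u ht hu
      refine (hF _ _ (sh a t ha ht) (sh a u ha hu)).trans_eq ?_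
      rw [dist_node i _ _ _ _ _ his (na a ha) (nb t ht) (na a ha) (nb u hu), dist_self]; ring
    have step1 : Ex (.node i l r) (fun t => Real.exp (lam * F t)) ≤
        Ex l (fun a => Real.exp (lam ^ 2 * (K / 2) ^ 2 * V r / 8) *
          Real.exp (lam * Ex r (fun b => F (.node i a b)))) := by
      simp only [Ex]
      refine Ex_mono _ _ _ fun a ha => ?_
      rw [← Real.exp_add, add_comm]
      exact ihr _ hr (K / 2) lam (fun b => F (.node i a b)) (L2 a ha)
    refine step1.trans ?_
    rw [Ex_mul]
    have L3 : ∀ t u, shp t = l → shp u = l →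
        |Ex r (fun b => F (.node i t b)) - Ex r (fun b => F (.node i u b))|
          ≤ K / 2 * dist t u := by
      intro t u ht hu
      have key : ∀ t u, shp t = l → shp u = l →
          Ex r (fun b => F (.node i t b)) ≤ Ex r (fun b => F (.node i u b)) + K / 2 * dist t u := by
        intro t u ht hu
        rw [← Ex_const r (K / 2 * dist t u), ← Ex_add]
        refine Ex_mono _ _ _ fun b hb => ?_
        have := (abs_le.1 (L1 b hb t u ht hu)).2
        linarith
      have k1 := key t u ht hu
      have k2 := key u t hu ht
      rw [dist_comm] at k2
      rw [abs_le]; constructor <;> linarith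
    have step2 := ihl _ hl (K / 2) lam _ L3
    refine (mul_le_mul_of_nonneg_left step2 (Real.exp_pos _).le).trans_eq ?_
    rw [← Real.exp_add]
    simp only [Ex, V]
    congr 1; ring

lemma tail (S : DTree n Unit) (s : Finset (Fin n)) (hS : S.NonRedundantFrom s) (d k : ℕ)
    (hd : 0 < d) (hSd : S.depth ≤ d) (hk : k ≤ S.minDepth) (t : ℝ) (ht : 0 ≤ t) :
    Ex S (fun T => if sens T < k / 2 - t then 1 else 0)
      ≤ Real.exp (- (t ^ 2 * 2 ^ k / (2 * d ^ 2))) := by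
  set th : ℝ := t * 2 ^ k / d ^ 2 with hth
  have hd' : (0:ℝ) < d := by exact_mod_cast hd
  have hth0 : 0 ≤ th := by positivity
  have h1 : Ex S (fun T => if sens T < k / 2 - t then 1 else 0) ≤
      Ex S (fun T => Real.exp (th * (k / 2 - t)) * Real.exp ((-th) * sens T)) := by
    refine Ex_mono _ _ _ fun T _ => ?_
    rw [← Real.exp_add]
    split_ifs with h
    · apply Real.one_le_exp
      nlinarith
    · exact (Real.exp_pos _).le
  refine h1.trans ?_
  rw [Ex_mul]
  have h2 := mcd S s hS (2 * d) (-th) sens (by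
    intro a b ha hb
    refine (sens_lip S s hS a b ha hb).trans ?_
    have := dist_nonneg a b
    gcongr)
  refine (mul_le_mul_of_nonneg_left h2 (Real.exp_pos _).le).trans ?_
  rw [← Real.exp_add, Real.exp_le_exp]
  have h3 : (k:ℝ) / 2 ≤ Ex S sens := by
    refine le_trans ?_ (Ex_sens S s hS)
    gcongr
  have h4 : V S ≤ (1 / 2) ^ k :=
    (V_le S).trans (pow_le_pow_of_le_one (by norm_num) (by norm_num) hk)
  have h5 : (-th) ^ 2 * (2 * (d:ℝ)) ^ 2 * V S / 8 ≤ th ^ 2 * d ^ 2 * (1 / 2) ^ k / 2 := by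
    have := mul_le_mul_of_nonneg_left h4 (show 0 ≤ th ^ 2 * (d:ℝ) ^ 2 by positivity)
    nlinarith
  have h6 : th ^ 2 * d ^ 2 * (1 / 2) ^ k / 2 = t ^ 2 * 2 ^ k / (2 * d ^ 2) := by
    rw [hth, one_div, inv_pow]; field_simp
  have h7 : th * t = t ^ 2 * 2 ^ k / (2 * d ^ 2) + t ^ 2 * 2 ^ k / (2 * d ^ 2) := by
    rw [hth]; field_simp; ring
  nlinarith [mul_le_mul_of_nonneg_left h3 hth0]

/-- Embedding of the top-level data into trees. -/
def topEmb : (Bool ⊕ (Σ _ : Fin n, DTree n Bool × DTree n Bool)) ↪ DTree n Bool where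
  toFun := fun p => match p with
    | .inl b => .leaf b
    | .inr ⟨i, a, b⟩ => .node i a b
  inj' := by
    rintro (b | ⟨i, a, b⟩) (b' | ⟨i', a', b'⟩) h <;> simp_all

lemma topEmb_inl (b : Bool) : (topEmb (.inl b) : DTree n Bool) = .leaf b := rfl

lemma topEmb_inr (i : Fin n) (a b : DTree n Bool) : topEmb (.inr ⟨i, a, b⟩) = .node i a b := rfl

/-- All nonredundant trees of depth at most `d` avoiding `s`. -/
noncomputable def trees : ℕ → Finset (Fin n) → Finset (DTree n Bool)
  | 0, _ => (Finset.univ.disjSum ∅).map topEmb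
  | d + 1, s => (Finset.univ.disjSum
      (sᶜ.sigma fun i => trees d (insert i s) ×ˢ trees d (insert i s))).map topEmb

lemma mem_trees : ∀ (t : DTree n Bool) (d : ℕ) (s : Finset (Fin n)),
    t ∈ trees d s ↔ t.NonRedundantFrom s ∧ t.depth ≤ d := by
  intro t
  induction t with
  | leaf b =>
    intro d s
    have h : ∀ X, (DTree.leaf b : DTree n Bool) ∈ Finset.map topEmb X ↔ .inl b ∈ X := by
      intro X; rw [← topEmb_inl, Finset.mem_map']
    cases d <;> simp only [trees, h] <;> simp [NonRedundantFrom, depth]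
  | node i l r ihl ihr =>
    intro d s
    have h : ∀ X, (DTree.node i l r : DTree n Bool) ∈ Finset.map topEmb X ↔
        .inr ⟨i, l, r⟩ ∈ X := by
      intro X; rw [← topEmb_inr, Finset.mem_map']
    cases d with
    | zero =>
      simp only [trees, h]
      simp [depth]
    | succ d =>
      simp only [trees, h]
      simp [NonRedundantFrom, depth, ihl, ihr]
      tauto

lemma sum_trees_zero (s : Finset (Fin n)) (F : DTree n Bool → ℝ) :
    ∑ t ∈ trees 0 s, F t = F (.leaf true) + F (.leaf false) := by
  simp [trees, topEmb_inl]

lemma sum_trees_succ (d : ℕ) (s : Finset (Fin n)) (F : DTree n Bool → ℝ) :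
    ∑ t ∈ trees (d + 1) s, F t = F (.leaf true) + F (.leaf false) +
      ∑ i ∈ sᶜ, ∑ a ∈ trees d (insert i s), ∑ b ∈ trees d (insert i s), F (.node i a b) := by
  simp [trees, topEmb_inl, topEmb_inr, Finset.sum_sigma, Finset.sum_product]

/-- number of trees -/
noncomputable def N (d : ℕ) (s : Finset (Fin n)) : ℝ := ∑ _t ∈ trees d s, 1

/-- number of trees with a shallow leaf -/
noncomputable def B (d : ℕ) (s : Finset (Fin n)) (k : ℕ) : ℝ :=
  ∑ t ∈ trees d s, if t.minDepth < k then 1 else 0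

lemma N_succ (d : ℕ) (s : Finset (Fin n)) :
    N (d + 1) s = 2 + ∑ i ∈ sᶜ, N d (insert i s) ^ 2 := by
  simp only [N, sum_trees_succ]
  simp [sq]; norm_num

lemma N_ge (d : ℕ) : ∀ s : Finset (Fin n), s.card + d ≤ n → (2:ℝ) ^ (2 ^ d) ≤ N d s := by
  induction d with
  | zero => intro s _; simp only [N, sum_trees_zero]; norm_num
  | succ d ih =>
    intro s hs
    rw [N_succ]
    have hne : sᶜ.Nonempty := by
      rw [← Finset.card_pos, Finset.card_compl, Fintype.card_fin]; omega
    obtain ⟨i, hi⟩ := hne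
    have h1 := Finset.single_le_sum (f := fun i => N d (insert i s) ^ 2)
      (fun i _ => sq_nonneg _) hi
    have h2 := ih (insert i s) (by
      have := Finset.card_insert_le i s
      omega)
    have h3 : (2:ℝ) ^ 2 ^ (d + 1) = (2 ^ 2 ^ d) ^ 2 := by rw [← pow_mul, pow_succ]
    have h4 := pow_le_pow_left₀ (by positivity) h2 2
    rw [h3]
    linarith

lemma B_le (e k : ℕ) : ∀ s : Finset (Fin n), s.card + (k + e) ≤ n →
    B (k + e) s k * 2 ^ (2 ^ e) ≤ (2 ^ (k + 1) - 2) * N (k + e) s := by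
  induction k with
  | zero => intro s _; simp [B]
  | succ k ih =>
    intro s hs
    have h1 : B (k + 1 + e) s (k + 1) ≤ 2 +
        ∑ i ∈ sᶜ, 2 * (B (k + e) (insert i s) k * N (k + e) (insert i s)) := by
      rw [show k + 1 + e = (k + e) + 1 by ring]
      rw [B, sum_trees_succ]
      gcongr with i hi
      · simp [minDepth]; norm_num
      · have : ∀ a b : DTree n Bool, (if (DTree.node i a b).minDepth < k + 1 then (1:ℝ) else 0)
            ≤ (if a.minDepth < k then 1 else 0) + (if b.minDepth < k then 1 else 0) := by
          intro a b
          simp only [minDepth]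
          by_cases h1 : a.minDepth < k <;> by_cases h2 : b.minDepth < k <;> simp [h1, h2]
        refine (Finset.sum_le_sum fun a _ => Finset.sum_le_sum fun b _ => this a b).trans_eq ?_
        simp only [Finset.sum_add_distrib, Finset.sum_const, nsmul_eq_mul, ← Finset.mul_sum, B, N]
        ring
    have h2 : ∀ i ∈ sᶜ, 2 * (B (k + e) (insert i s) k * N (k + e) (insert i s)) * 2 ^ (2 ^ e)
        ≤ 2 * (2 ^ (k + 1) - 2) * N (k + e) (insert i s) ^ 2 := by
      intro i hi
      have h := ih (insert i s) (by
        have := Finset.card_insert_le i s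
        omega)
      have hN : 0 ≤ N (k + e) (insert i s) := by simp [N]
      nlinarith [mul_le_mul_of_nonneg_right h hN]
    have h3 : (2:ℝ) ^ 2 ^ e ≤ N (k + 1 + e) s := by
      refine le_trans ?_ (N_ge _ s hs)
      apply pow_le_pow_right₀ (by norm_num)
      apply pow_le_pow_right₀ (by norm_num)
      omega
    have h4 := Finset.sum_le_sum h2
    rw [← Finset.sum_mul, ← Finset.mul_sum, ← Finset.mul_sum] at h4
    rw [← Finset.mul_sum] at h1
    have h5 := N_succ (k + e) s
    rw [show k + e + 1 = k + 1 + e by ring] at h5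
    have h6 : (0:ℝ) < 2 ^ 2 ^ e := by positivity
    have h7 := mul_le_mul_of_nonneg_right h1 h6.le
    have h8 : (2:ℝ) ≤ 2 ^ (k + 1) := by
      calc (2:ℝ) = 2 ^ 1 := by norm_num
        _ ≤ _ := pow_le_pow_right₀ (by norm_num) (by omega)
    have h9 : (2:ℝ) ^ (k + 1 + 1) = 2 * 2 ^ (k + 1) := by ring
    rw [h9]
    have h10 : ∑ i ∈ sᶜ, N (k + e) (insert i s) ^ 2 = N (k + 1 + e) s - 2 := by linarith
    rw [h10] at h4
    nlinarith

/-- embedding for nodes -/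
def nodeEmb (i : Fin n) : (DTree n Bool × DTree n Bool) ↪ DTree n Bool where
  toFun := fun p => .node i p.1 p.2
  inj' := by
    rintro ⟨a, b⟩ ⟨a', b'⟩ h; simp_all

/-- embedding for leaves -/
def leafEmb : Bool ↪ DTree n Bool where
  toFun := fun p => .leaf p
  inj' := by
    rintro a a' h; simp_all

lemma nodeEmb_apply (i : Fin n) (p) : nodeEmb i p = .node i p.1 p.2 := rfl

lemma leafEmb_apply (p) : (leafEmb p : DTree n Bool) = .leaf p := rfl

/-- all labellings of a shape -/
def lab : DTree n Unit → Finset (DTree n Bool)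
  | .leaf _ => Finset.univ.map leafEmb
  | .node i l r => (lab l ×ˢ lab r).map (nodeEmb i)

lemma mem_lab (S : DTree n Unit) : ∀ t, t ∈ lab S ↔ shp t = S := by
  induction S with
  | leaf u => intro t; rw [shp_leaf_iff]; simp [lab, leafEmb_apply, eq_comm]
  | node i l r ihl ihr =>
    intro t; rw [shp_node_iff]; simp [lab, nodeEmb_apply, ihl, ihr]
    constructor
    · rintro ⟨a, b, ⟨h1, h2⟩, h⟩; exact ⟨a, b, h.symm, h1, h2⟩
    · rintro ⟨a, b, h, h1, h2⟩; exact ⟨a, b, ⟨h1, h2⟩, h.symm⟩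

lemma sum_lab (S : DTree n Unit) : ∀ F : DTree n Bool → ℝ,
    ∑ t ∈ lab S, F t = (lab S).card * Ex S F := by
  induction S with
  | leaf u => intro F; simp [lab, leafEmb_apply, Ex]; ring
  | node i l r ihl ihr =>
    intro F
    simp [lab, nodeEmb_apply, Ex, Finset.sum_product, ihr, ihl, Ex_mul]; ring

lemma count_bad (d k : ℕ) (hd : 0 < d) (t : ℝ) (ht : 0 ≤ t) :
    ∑ T ∈ trees d (∅ : Finset (Fin n)),
      (if k ≤ T.minDepth ∧ sens T < k / 2 - t then (1:ℝ) else 0)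
      ≤ Real.exp (- (t ^ 2 * 2 ^ k / (2 * d ^ 2))) * N d (∅ : Finset (Fin n)) := by
  classical
  set A := trees d (∅ : Finset (Fin n))
  have fib : ∀ S ∈ A.image shp, A.filter (fun T => shp T = S) = lab S := by
    intro S hS
    obtain ⟨T, hT, rfl⟩ := Finset.mem_image.1 hS
    ext T'
    rw [Finset.mem_filter, mem_lab]
    refine ⟨fun h => h.2, fun h => ⟨?_, h⟩⟩
    rw [mem_trees, ← nonred_shp, ← depth_shp] at hT ⊢
    rwa [h]
  have maps : ∀ T ∈ A, shp T ∈ A.image shp := fun T hT => Finset.mem_image_of_mem _ hT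
  rw [N, ← Finset.sum_fiberwise_of_maps_to maps, ← Finset.sum_fiberwise_of_maps_to maps (fun _ => (1:ℝ)),
    Finset.mul_sum]
  refine Finset.sum_le_sum fun S hS => ?_
  rw [fib S hS, sum_lab, sum_lab, Ex_const, mul_one, mul_comm]
  refine mul_le_mul_of_nonneg_right ?_ (Nat.cast_nonneg _)
  obtain ⟨T, hT, rfl⟩ := Finset.mem_image.1 hS
  rw [mem_trees, ← nonred_shp, ← depth_shp] at hT
  by_cases hk : k ≤ (shp T).minDepth
  · refine le_trans (Ex_mono _ _ _ fun T' _ => ?_) (tail (shp T) ∅ hT.1 d k hd hT.2 hk t ht)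
    by_cases h1 : sens T' < k / 2 - t <;> simp only [h1, and_true, and_false, if_true, if_false]
    · split_ifs <;> norm_num
    · exact le_refl _
  · rw [Ex_congr _ _ (fun _ => 0), Ex_const]
    · exact (Real.exp_pos _).le
    · intro T' hT'
      rw [← hT', minDepth_shp] at hk
      simp [hk]

end RDT

/-- Fix `n ≥ d` with `d/3 ≥ log₂ d + 2`, and let `T` be picked uniformly
at random from the set of all non-redundant decision trees of depth at most `d` on `n`
boolean variables (trees with different variable labels on internal vertices or different
labels on leaves being counted as distinct). Then for every `ε` with `0 < ε < 1`,
`Pr_T[s̄(T) < (1-ε) d/3] ≤ 2^{1 - 2^{d/3 - 2}} + exp(-2^{d/3 - 3} ε²)`, where `s̄(T)` is the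
average sensitivity of the boolean function computed by `T`. -/
theorem random_decision_tree_avgSens_lower_bound (n d : ℕ) (hnd : d ≤ n)
    (hd : Real.logb 2 d + 2 ≤ (d : ℝ) / 3)
    (ε : ℝ) (hε0 : 0 < ε) (hε1 : ε < 1) :
    (Set.ncard {t : DTree n Bool | t.NonRedundant ∧ t.depth ≤ d ∧
        avgSens (fun x => t.eval x) < (1 - ε) * d / 3} : ℝ) /
      Set.ncard {t : DTree n Bool | t.NonRedundant ∧ t.depth ≤ d}
      ≤ (2 : ℝ) ^ ((1 : ℝ) - (2 : ℝ) ^ ((d : ℝ) / 3 - 2))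
          + Real.exp (-(2 : ℝ) ^ ((d : ℝ) / 3 - 3) * ε ^ 2) := by
  classical
  have hd0 : 0 < d := by
    rcases Nat.eq_zero_or_pos d with h | h
    · subst h; norm_num at hd
    · exact h
  have hdR : (0:ℝ) < d := by exact_mod_cast hd0
  have hd1 : (1:ℝ) ≤ d := by exact_mod_cast hd0
  set X : ℝ := (2:ℝ) ^ ((d:ℝ) / 3) with hX
  have hX4 : 4 * (d:ℝ) ≤ X := by
    have h := Real.rpow_le_rpow_of_exponent_le (x := 2) (by norm_num) hd
    rw [Real.rpow_add (by norm_num), Real.rpow_logb (by norm_num) (by norm_num) hdR] at h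
    norm_num at h
    linarith
  obtain ⟨e, k, hke, he, hk⟩ : ∃ e k : ℕ, k + e = d ∧ d ≤ 3 * e + 2 ∧ 2 * d ≤ 3 * k :=
    ⟨d / 3, d - d / 3, by omega, by omega, by omega⟩
  have hkR : 2 * (d:ℝ) ≤ 3 * k := by exact_mod_cast hk
  have heR : (d:ℝ) ≤ 3 * e + 2 := by exact_mod_cast he
  have hkd : (k:ℝ) ≤ d := by exact_mod_cast (by omega : k ≤ d)
  have hset : {t : DTree n Bool | t.NonRedundant ∧ t.depth ≤ d}
      = ((RDT.trees d ∅ : Finset (DTree n Bool)) : Set (DTree n Bool)) := by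
    ext t; simp [RDT.mem_trees, DTree.NonRedundant]
  have hset2 : {t : DTree n Bool | t.NonRedundant ∧ t.depth ≤ d ∧
        avgSens (fun x => t.eval x) < (1 - ε) * d / 3}
      = (((RDT.trees d ∅).filter (fun t => RDT.sens t < (1 - ε) * d / 3) :
          Finset (DTree n Bool)) : Set (DTree n Bool)) := by
    ext t
    rw [Finset.mem_coe, Finset.mem_filter, RDT.mem_trees, and_assoc]
    rfl
  rw [hset, hset2, Set.ncard_coe_finset, Set.ncard_coe_finset]
  have hN : ((RDT.trees d (∅ : Finset (Fin n))).card : ℝ) = RDT.N d (∅ : Finset (Fin n)) := by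
    simp [RDT.N]
  have hNpos : 0 < RDT.N d (∅ : Finset (Fin n)) :=
    lt_of_lt_of_le (by positivity) (RDT.N_ge d ∅ (by simpa using hnd))
  rw [hN, div_le_iff₀ hNpos, add_mul]
  set t : ℝ := k / 2 - (1 - ε) * d / 3 with ht
  have ht1 : ε * d / 3 ≤ t := by rw [ht]; linarith
  have ht0 : 0 ≤ t := le_trans (by positivity) ht1
  have hB := RDT.B_le e k (∅ : Finset (Fin n)) (by simp; omega)
  rw [hke] at hB
  have hC := RDT.count_bad (n := n) d k hd0 t ht0
  have hsum : (((RDT.trees d ∅).filter (fun t => RDT.sens t < (1 - ε) * d / 3) :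
          Finset (DTree n Bool)).card : ℝ) ≤ RDT.B d (∅ : Finset (Fin n)) k +
      ∑ T ∈ RDT.trees d (∅ : Finset (Fin n)),
      (if k ≤ T.minDepth ∧ RDT.sens T < k / 2 - t then (1:ℝ) else 0) := by
    rw [Finset.card_filter, RDT.B, ← Finset.sum_add_distrib]
    push_cast
    refine Finset.sum_le_sum fun T _ => ?_
    have : (k:ℝ) / 2 - t = (1 - ε) * d / 3 := by rw [ht]; ring
    rw [this]
    by_cases h1 : RDT.sens T < (1 - ε) * d / 3 <;> by_cases h2 : T.minDepth < k <;>
      simp [h1, h2, not_le.2, not_lt.1]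
  refine hsum.trans (add_le_add ?_ (hC.trans ?_))
  · have h1 : RDT.B d (∅ : Finset (Fin n)) k ≤ 2 ^ (k + 1) / 2 ^ 2 ^ e * RDT.N d (∅ : Finset (Fin n)) := by
      rw [div_mul_eq_mul_div, le_div_iff₀ (by positivity)]
      nlinarith
    refine h1.trans (mul_le_mul_of_nonneg_right ?_ hNpos.le)
    have h2 : ((2:ℝ) ^ (k + 1) / 2 ^ 2 ^ e) = (2:ℝ) ^ (((k + 1 : ℕ) : ℝ) - ((2 ^ e : ℕ) : ℝ)) := by
      rw [Real.rpow_sub (by norm_num), Real.rpow_natCast, Real.rpow_natCast]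
    rw [h2]
    apply Real.rpow_le_rpow_of_exponent_le (by norm_num)
    have h3 : X / 2 ≤ (2:ℝ) ^ e := by
      rw [← Real.rpow_natCast, hX, ← Real.rpow_sub_one (by norm_num)]
      apply Real.rpow_le_rpow_of_exponent_le (by norm_num)
      linarith
    have h4 : (2:ℝ) ^ ((d:ℝ) / 3 - 2) = X / 4 := by
      rw [hX, Real.rpow_sub (by norm_num)]; norm_num
    rw [h4]
    push_cast
    linarith
  · refine mul_le_mul_of_nonneg_right ?_ hNpos.le
    rw [Real.exp_le_exp, neg_mul, neg_le_neg_iff]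
    have h4 : (2:ℝ) ^ ((d:ℝ) / 3 - 3) = X / 8 := by
      rw [hX, Real.rpow_sub (by norm_num)]; norm_num
    have h5 : X * X ≤ (2:ℝ) ^ k := by
      rw [← Real.rpow_natCast, hX, ← Real.rpow_add (by norm_num)]
      apply Real.rpow_le_rpow_of_exponent_le (by norm_num)
      linarith
    have hX0 : 0 < X := by linarith
    have h6 : (ε * d / 3) ^ 2 ≤ t ^ 2 := pow_le_pow_left₀ (by positivity) ht1 2
    rw [h4, le_div_iff₀ (by positivity)]
    calc X / 8 * ε ^ 2 * (2 * d ^ 2) ≤ (ε * d / 3) ^ 2 * (X * X) := by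
          have : X * (9 / 4) ≤ X * X := by gcongr; linarith
          have := mul_le_mul_of_nonneg_left this (show 0 ≤ (ε * d / 3) ^ 2 by positivity)
          nlinarith
      _ ≤ t ^ 2 * 2 ^ k := by gcongr
end
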